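/- Uniqueness for the inverse problem IP-0: consider two boundary value problems with the same T, N, nodes b_j and jump coefficients γ_j ≠ 0, one with data (p, q, η'_j, η_j) and one with data (p̃, q̃, η̃'_j, η̃_j), and assume ξ_j^± := (γ_j + γ_j^{−1})/2 ∓ η'_j/2 ≠ 0 and ξ̃_j^± := (γ_j + γ_j^{−1})/2 ∓ η̃'_j/2 ≠ 0 for all j. Let S, C (resp. S̃, C̃) be the corresponding fundamental solutions with jumps, and put d(ρ) = S(T,ρ), d_1(ρ) = C(T,ρ), d̃(ρ) = S̃(T,ρ), d̃_1(ρ) = C̃(T,ρ). Suppose the spectral data coincide: (i) for every z ∈ ℂ the order of z as a zero of d equals its order as a zero of d̃, and (ii) at every such zero ν the principal parts of the Weyl-type functions M = −d_1/d and M̃ = −d̃_1/d̃ coincide, i.e., M − M̃ extends analytically to ν. Then p = p̃ a.e. on (0,T), q = q̃ a.e. on (0,T), and η'_j = η̃'_j, η_j = η̃_j for j = 1,…,N−1. -/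

import Mathlib

open MeasureTheory Set Filter Complex intervalIntegral
open scoped Topology

noncomputable section

/-- `y` (with derivative `y'`) solves the pencil equation
`y'' + (ρ² + ρ p x + q x) y = 0` on the open interval `(c, d)`:
`y` is differentiable with derivative `y'` there, and `y'` is absolutely continuous
with `y'' = -(ρ² + ρ p + q) y` almost everywhere, which is encoded by the
integral equation for `y'`. -/
def PencilSolOn (p q : ℝ → ℂ) (ρ : ℂ) (y y' : ℝ → ℂ) (c d : ℝ) : Prop :=
  (∀ x ∈ Set.Ioo c d, HasDerivAt y (y' x) x) ∧
  (∀ u ∈ Set.Ioo c d, ∀ v ∈ Set.Ioo c d,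
    y' v - y' u = ∫ t in u..v, -((ρ ^ 2 + ρ * p t + q t) * y t))

/-- A solution with jumps of the pencil equation on `[b 0, b N]`, together with its
one-sided limits at the nodes `b j`.  The fields `yL j, yL' j` (resp. `yR j, yR' j`)
are the one-sided limits `y (b j - 0), y' (b j - 0)` (resp. `y (b j + 0), y' (b j + 0)`).
The values of `y, y'` at the endpoints `b 0` and `b N` are understood as the
corresponding one-sided limits, and the jump conditions hold at the interior nodes
`b 1, …, b (N-1)`. -/
structure JumpSolution (N : ℕ) (b : ℕ → ℝ) (p q : ℝ → ℂ)
    (γ η' η : ℕ → ℂ) (ρ : ℂ) where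
  y : ℝ → ℂ
  y' : ℝ → ℂ
  yL : ℕ → ℂ
  yL' : ℕ → ℂ
  yR : ℕ → ℂ
  yR' : ℕ → ℂ
  solves : ∀ j, 1 ≤ j → j ≤ N →
    PencilSolOn p q ρ y y' (b (j - 1)) (b j)
  limL : ∀ j, 1 ≤ j → j ≤ N →
    Filter.Tendsto y (nhdsWithin (b j) (Set.Iio (b j))) (nhds (yL j)) ∧
    Filter.Tendsto y' (nhdsWithin (b j) (Set.Iio (b j))) (nhds (yL' j))
  limR : ∀ j, j + 1 ≤ N →
    Filter.Tendsto y (nhdsWithin (b j) (Set.Ioi (b j))) (nhds (yR j)) ∧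
    Filter.Tendsto y' (nhdsWithin (b j) (Set.Ioi (b j))) (nhds (yR' j))
  jump : ∀ j, 1 ≤ j → j + 1 ≤ N →
    yR j = γ j * yL j ∧
    yR' j = (γ j)⁻¹ * yL' j + (Complex.I * ρ * η' j + η j) * yL j
  left_end : y (b 0) = yR 0 ∧ y' (b 0) = yR' 0
  right_end : y (b N) = yL N ∧ y' (b N) = yL' N

/-- `p` is absolutely continuous on `[a, b]`. -/
def AbsCont (p : ℝ → ℂ) (a b : ℝ) : Prop :=
  ∃ p' : ℝ → ℂ, MeasureTheory.IntegrableOn p' (Set.Icc a b) ∧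
    ∀ x ∈ Set.Icc a b, p x = p a + ∫ t in a..x, p' t

/-- A map that varies at most a constant times as much as an absolutely continuous one is
absolutely continuous. -/
theorem AbsolutelyContinuousOnInterval.of_dist_le {X Y : Type*} [PseudoMetricSpace X]
    [PseudoMetricSpace Y] {f : ℝ → X} {g : ℝ → Y} {a b K : ℝ}
    (hg : AbsolutelyContinuousOnInterval g a b)
    (h : ∀ x ∈ uIcc a b, ∀ y ∈ uIcc a b, dist (f x) (f y) ≤ K * dist (g x) (g y)) :
    AbsolutelyContinuousOnInterval f a b := by
  rw [absolutelyContinuousOnInterval_iff] at hg ⊢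
  intro ε hε
  obtain ⟨δ, hδ, H⟩ := hg (ε / (|K| + 1)) (by positivity)
  refine ⟨δ, hδ, fun E hE hlt => ?_⟩
  have hE' := hE.1
  calc ∑ i ∈ Finset.range E.1, dist (f (E.2 i).1) (f (E.2 i).2)
      ≤ ∑ i ∈ Finset.range E.1, (|K| + 1) * dist (g (E.2 i).1) (g (E.2 i).2) := by
        refine Finset.sum_le_sum fun i hi => ?_
        refine (h _ (hE' i hi).1 _ (hE' i hi).2).trans ?_
        gcongr
        linarith [le_abs_self K]
    _ = (|K| + 1) * ∑ i ∈ Finset.range E.1, dist (g (E.2 i).1) (g (E.2 i).2) := by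
        rw [Finset.mul_sum]
    _ < ε := by
        have := H E hE hlt
        rw [lt_div_iff₀ (by positivity)] at this
        linarith

/-- `f` is a primitive on `[c, d]` of the integrable function `f'`. -/
def IsPrimitiveOn {E : Type*} [NormedAddCommGroup E] [NormedSpace ℝ E] (f f' : ℝ → E)
    (c d : ℝ) : Prop :=
  IntervalIntegrable f' volume c d ∧ ∀ x ∈ Icc c d, f x = f c + ∫ t in c..x, f' t

namespace IsPrimitiveOn

section Basic

variable {E : Type*} [NormedAddCommGroup E] [NormedSpace ℝ E] {f g f' g' : ℝ → E} {c d : ℝ}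

theorem intervalIntegrable_sub (h : IsPrimitiveOn f f' c d) {x y : ℝ} (hx : x ∈ Icc c d)
    (hy : y ∈ Icc c d) : IntervalIntegrable f' volume x y := by
  have hcd : c ≤ d := hx.1.trans hx.2
  refine h.1.mono_set ?_
  rw [uIcc_of_le hcd]
  exact uIcc_subset_Icc hx hy

theorem sub_eq (h : IsPrimitiveOn f f' c d) {x y : ℝ} (hx : x ∈ Icc c d)
    (hy : y ∈ Icc c d) : f y - f x = ∫ t in x..y, f' t := by
  have hc : c ∈ Icc c d := ⟨le_rfl, hx.1.trans hx.2⟩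
  rw [h.2 x hx, h.2 y hy, add_sub_add_left_eq_sub, integral_interval_sub_left
    (h.intervalIntegrable_sub hc hy) (h.intervalIntegrable_sub hc hx)]

theorem mono (h : IsPrimitiveOn f f' c d) {x y : ℝ} (hx : x ∈ Icc c d) (hy : y ∈ Icc c d) :
    IsPrimitiveOn f f' x y := by
  refine ⟨h.intervalIntegrable_sub hx hy, fun t ht => ?_⟩
  rw [← h.sub_eq hx ⟨hx.1.trans ht.1, ht.2.trans hy.2⟩]
  abel

theorem congr (h : IsPrimitiveOn f f' c d) (hcd : c ≤ d) (hfg : ∀ x ∈ Icc c d, f x = g x)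
    (hfg' : ∀ x ∈ Icc c d, f' x = g' x) : IsPrimitiveOn g g' c d := by
  have key : ∀ x ∈ Icc c d, EqOn f' g' (uIoc c x) := fun x hx t ht => by
    rw [uIoc_of_le hx.1] at ht
    exact hfg' t ⟨ht.1.le, ht.2.trans hx.2⟩
  refine ⟨h.1.congr (key d ⟨hcd, le_rfl⟩), fun x hx => ?_⟩
  rw [← hfg x hx, ← hfg c ⟨le_rfl, hcd⟩, h.2 x hx, intervalIntegral.integral_congr_ae]
  exact Eventually.of_forall fun t ht => key x hx ht

theorem ac (h : IsPrimitiveOn f f' c d) (hcd : c ≤ d) :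
    AbsolutelyContinuousOnInterval f c d := by
  have h1 := (h.1.norm).absolutelyContinuousOnInterval_intervalIntegral
    (c := c) (by simp)
  refine AbsolutelyContinuousOnInterval.of_dist_le (K := 1) h1 fun x hx y hy => ?_
  rw [uIcc_of_le hcd] at hx hy
  have hc : c ∈ Icc c d := ⟨le_rfl, hcd⟩
  rw [one_mul, dist_comm, dist_eq_norm, h.sub_eq hx hy, dist_comm, Real.dist_eq,
    integral_interval_sub_left (h.intervalIntegrable_sub hc hy).norm
    (h.intervalIntegrable_sub hc hx).norm]
  exact norm_integral_le_abs_integral_norm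

theorem continuousOn (h : IsPrimitiveOn f f' c d) (hcd : c ≤ d) : ContinuousOn f (Icc c d) := by
  have := (h.ac hcd).continuousOn
  rwa [uIcc_of_le hcd] at this

theorem const (a : E) : IsPrimitiveOn (fun _ => a) (fun _ => 0) c d :=
  ⟨intervalIntegrable_const, fun x _ => by simp⟩

theorem add (hf : IsPrimitiveOn f f' c d) (hg : IsPrimitiveOn g g' c d) :
    IsPrimitiveOn (fun x => f x + g x) (fun x => f' x + g' x) c d := by
  refine ⟨hf.1.add hg.1, fun x hx => ?_⟩
  have hc : c ∈ Icc c d := ⟨le_rfl, hx.1.trans hx.2⟩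
  beta_reduce
  rw [intervalIntegral.integral_add (hf.intervalIntegrable_sub hc hx) (hg.intervalIntegrable_sub hc hx), hf.2 x hx,
    hg.2 x hx]
  abel

theorem neg (hf : IsPrimitiveOn f f' c d) :
    IsPrimitiveOn (fun x => - f x) (fun x => - f' x) c d := by
  refine ⟨hf.1.neg, fun x hx => ?_⟩
  beta_reduce
  rw [intervalIntegral.integral_neg, hf.2 x hx]
  abel

theorem sub (hf : IsPrimitiveOn f f' c d) (hg : IsPrimitiveOn g g' c d) :
    IsPrimitiveOn (fun x => f x - g x) (fun x => f' x - g' x) c d := by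
  simpa [sub_eq_add_neg] using hf.add hg.neg

/-- Reflection `x ↦ T - x` of a primitive. -/
theorem reflect (h : IsPrimitiveOn f f' c d) (T : ℝ) :
    IsPrimitiveOn (fun x => f (T - x)) (fun x => - f' (T - x)) (T - d) (T - c) := by
  refine ⟨((h.1.comp_sub_left T).symm).neg, fun x hx => ?_⟩
  have hx' : T - x ∈ Icc c d := ⟨by linarith [hx.2], by linarith [hx.1]⟩
  have hd : d ∈ Icc c d := ⟨hx'.1.trans hx'.2, le_rfl⟩
  rw [intervalIntegral.integral_neg, intervalIntegral.integral_comp_sub_left (fun t => f' t) T]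
  simp only [sub_sub_cancel]
  rw [← h.sub_eq hx' hd]
  abel

theorem of_hasDerivAt [CompleteSpace E] (hf : ContinuousOn f (Icc c d))
    (hd : ∀ x ∈ Ioo c d, HasDerivAt f (f' x) x) (hi : IntervalIntegrable f' volume c d) :
    IsPrimitiveOn f f' c d := by
  refine ⟨hi, fun x hx => ?_⟩
  have hcd : c ≤ d := hx.1.trans hx.2
  have : IntervalIntegrable f' volume c x := hi.mono_set <| by
    rw [uIcc_of_le hcd, uIcc_of_le hx.1]
    exact Icc_subset_Icc le_rfl hx.2
  rw [integral_eq_sub_of_hasDerivAt_of_le hx.1 (hf.mono (Icc_subset_Icc le_rfl hx.2))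
    (fun t ht => hd t ⟨ht.1, ht.2.trans_le hx.2⟩) this]
  abel

theorem ae_hasDerivAt [CompleteSpace E] (h : IsPrimitiveOn f f' c d) :
    ∀ᵐ x, x ∈ Ioo c d → HasDerivAt f (f' x) x := by
  filter_upwards [h.1.ae_hasDerivAt_integral] with x hx hxm
  have hcd : c ≤ d := (hxm.1.trans hxm.2).le
  rw [uIcc_of_le hcd] at hx
  have := (hx (Ioo_subset_Icc_self hxm) c ⟨le_rfl, hcd⟩).const_add (f c)
  refine this.congr_of_eventuallyEq ?_
  filter_upwards [Ioo_mem_nhds hxm.1 hxm.2] with t ht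
  exact h.2 t (Ioo_subset_Icc_self ht)

theorem of_ac [CompleteSpace E] (hcd : c ≤ d) (hf : AbsolutelyContinuousOnInterval f c d)
    (hd : ∀ᵐ x, x ∈ Ioo c d → HasDerivAt f (f' x) x) (hi : IntervalIntegrable f' volume c d) :
    IsPrimitiveOn f f' c d := by
  set G : ℝ → E := fun x => ∫ t in c..x, f' t with hG
  have hGp : IsPrimitiveOn G f' c d := ⟨hi, fun x _ => by simp [hG]⟩
  have hac := hf.sub (hGp.ac hcd)
  have hz : ∀ᵐ x, x ∈ uIcc c d → HasDerivAt (f - G) 0 x := by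
    have h1 : ∀ᵐ x : ℝ, x ≠ c := by simp [ae_iff, measure_singleton]
    have h2 : ∀ᵐ x : ℝ, x ≠ d := by simp [ae_iff, measure_singleton]
    filter_upwards [hd, hGp.ae_hasDerivAt, h1, h2] with x h3 h4 h5 h6 hx
    rw [uIcc_of_le hcd] at hx
    have hx' : x ∈ Ioo c d := ⟨lt_of_le_of_ne hx.1 (Ne.symm h5), lt_of_le_of_ne hx.2 h6⟩
    simpa using (h3 hx').sub (h4 hx')
  obtain ⟨C, hC⟩ := hac.const_of_ae_hasDerivAt_zero hz
  refine ⟨hi, fun x hx => ?_⟩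
  rw [uIcc_of_le hcd] at hC
  have e1 := hC x hx
  have e2 := hC c ⟨le_rfl, hcd⟩
  have hGc : G c = 0 := by simp [hG]
  simp only [Pi.sub_apply, hGc, sub_zero] at e1 e2
  rw [e2, ← e1, hG]
  abel

/-- The integrand of a primitive is unique almost everywhere. -/
theorem ae_eq [CompleteSpace E] (hf : IsPrimitiveOn f f' c d) (hg : IsPrimitiveOn g g' c d)
    (hfg : ∀ x ∈ Ioo c d, f x = g x) : ∀ᵐ x, x ∈ Ioo c d → f' x = g' x := by
  filter_upwards [hf.ae_hasDerivAt, hg.ae_hasDerivAt] with x h1 h2 hx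
  refine (h1 hx).unique ((h2 hx).congr_of_eventuallyEq ?_)
  filter_upwards [Ioo_mem_nhds hx.1 hx.2] with t ht using hfg t ht

end Basic

section Mul

variable {𝕜 : Type*} [RCLike 𝕜] {f g f' g' : ℝ → 𝕜} {c d : ℝ}

theorem const_mul (a : 𝕜) (hf : IsPrimitiveOn f f' c d) :
    IsPrimitiveOn (fun x => a * f x) (fun x => a * f' x) c d := by
  refine ⟨hf.1.const_mul a, fun x hx => ?_⟩
  beta_reduce
  rw [intervalIntegral.integral_const_mul, hf.2 x hx]
  ring

theorem mul (hcd : c ≤ d) (hf : IsPrimitiveOn f f' c d) (hg : IsPrimitiveOn g g' c d) :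
    IsPrimitiveOn (fun x => f x * g x) (fun x => f' x * g x + f x * g' x) c d := by
  refine of_ac hcd ((hf.ac hcd).smul (hg.ac hcd)) ?_ ?_
  · filter_upwards [hf.ae_hasDerivAt, hg.ae_hasDerivAt] with x h1 h2 hx
    exact (h1 hx).mul (h2 hx)
  · refine (hf.1.mul_continuousOn ?_).add (hg.1.continuousOn_mul ?_) <;> rw [uIcc_of_le hcd]
    exacts [hg.continuousOn hcd, hf.continuousOn hcd]

end Mul

theorem complexExp {f f' : ℝ → ℂ} {c d : ℝ} (hcd : c ≤ d) (hf : IsPrimitiveOn f f' c d) :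
    IsPrimitiveOn (fun x => Complex.exp (f x)) (fun x => f' x * Complex.exp (f x)) c d := by
  have hcont := hf.continuousOn hcd
  obtain ⟨M, hM⟩ := isCompact_Icc.exists_bound_of_continuousOn hcont
  have hLip : ∃ K : NNReal, LipschitzOnWith K Complex.exp (Metric.closedBall 0 M) := by
    have : ContDiffOn ℝ 1 Complex.exp (Metric.closedBall (0 : ℂ) M) :=
      Complex.contDiff_exp.contDiffOn
    exact this.exists_lipschitzOnWith (by decide) (convex_closedBall _ _)
      (isCompact_closedBall _ _)
  obtain ⟨K, hK⟩ := hLip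
  refine of_ac hcd ((hf.ac hcd).of_dist_le (K := K) fun x hx y hy => ?_) ?_ ?_
  · rw [uIcc_of_le hcd] at hx hy
    exact hK.dist_le_mul _ (by simpa using hM x hx) _ (by simpa using hM y hy)
  · filter_upwards [hf.ae_hasDerivAt] with x h1 hx
    rw [mul_comm]
    exact (h1 hx).cexp
  · refine hf.1.mul_continuousOn ?_
    rw [uIcc_of_le hcd]
    exact hcont.cexp

theorem realExp {f f' : ℝ → ℝ} {c d : ℝ} (hcd : c ≤ d) (hf : IsPrimitiveOn f f' c d) :
    IsPrimitiveOn (fun x => Real.exp (f x)) (fun x => f' x * Real.exp (f x)) c d := by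
  have hcont := hf.continuousOn hcd
  obtain ⟨M, hM⟩ := isCompact_Icc.exists_bound_of_continuousOn hcont
  have hLip : ∃ K : NNReal, LipschitzOnWith K Real.exp (Metric.closedBall 0 M) := by
    have : ContDiffOn ℝ 1 Real.exp (Metric.closedBall (0 : ℝ) M) :=
      Real.contDiff_exp.contDiffOn
    exact this.exists_lipschitzOnWith (by decide) (convex_closedBall _ _)
      (isCompact_closedBall _ _)
  obtain ⟨K, hK⟩ := hLip
  refine of_ac hcd ((hf.ac hcd).of_dist_le (K := K) fun x hx y hy => ?_) ?_ ?_
  · rw [uIcc_of_le hcd] at hx hy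
    exact hK.dist_le_mul _ (by simpa using hM x hx) _ (by simpa using hM y hy)
  · filter_upwards [hf.ae_hasDerivAt] with x h1 hx
    rw [mul_comm]
    exact (h1 hx).exp
  · refine hf.1.mul_continuousOn ?_
    rw [uIcc_of_le hcd]
    exact hcont.rexp

end IsPrimitiveOn

/-- Gronwall's inequality with an integrable coefficient. -/
theorem gronwall_integrable {m a : ℝ → ℝ} {c d δ : ℝ} (hcd : c ≤ d)
    (hm : ContinuousOn m (Icc c d)) (ha : IntervalIntegrable a volume c d)
    (ha0 : ∀ t ∈ Icc c d, 0 ≤ a t)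
    (h : ∀ x ∈ Icc c d, m x ≤ δ + ∫ t in c..x, a t * m t) {x : ℝ} (hx : x ∈ Icc c d) :
    m x ≤ δ * Real.exp (∫ t in c..x, a t) := by
  have hi : IntervalIntegrable (fun t => a t * m t) volume c d :=
    ha.mul_continuousOn (by rwa [uIcc_of_le hcd])
  have h1 : IsPrimitiveOn (fun x => δ + ∫ t in c..x, a t * m t) (fun t => a t * m t) c d :=
    ⟨hi, fun x _ => by simp⟩
  have h2 : IsPrimitiveOn (fun x => - ∫ t in c..x, a t) (fun t => - a t) c d :=
    ⟨ha.neg, fun x _ => by simp⟩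
  have h3 := IsPrimitiveOn.mul hcd h1 (h2.realExp hcd)
  have hle : ∫ t in c..x, (a t * m t * Real.exp (- ∫ s in c..t, a s) +
      (δ + ∫ s in c..t, a s * m s) * (- a t * Real.exp (- ∫ s in c..t, a s))) ≤ 0 := by
    refine (integral_mono_on hx.1 (h3.intervalIntegrable_sub ⟨le_rfl, hcd⟩ hx)
      (g := fun _ => (0 : ℝ)) (by simp) fun t ht => ?_).trans (by simp)
    have ht' : t ∈ Icc c d := ⟨ht.1, ht.2.trans hx.2⟩
    have := h t ht'
    have e : a t * m t * Real.exp (- ∫ s in c..t, a s) +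
      (δ + ∫ s in c..t, a s * m s) * (- a t * Real.exp (- ∫ s in c..t, a s)) =
      - (a t * Real.exp (- ∫ s in c..t, a s) * ((δ + ∫ s in c..t, a s * m s) - m t)) := by ring
    rw [e]
    have h5 := ha0 t ht'
    have : 0 ≤ (δ + ∫ s in c..t, a s * m s) - m t := by linarith
    have := mul_nonneg (mul_nonneg h5 (Real.exp_pos (- ∫ s in c..t, a s)).le) this
    linarith
  have h4 := h3.2 x hx
  simp only [integral_same, add_zero, neg_zero, Real.exp_zero, mul_one] at h4
  have h5 : (δ + ∫ t in c..x, a t * m t) * Real.exp (- ∫ t in c..x, a t) ≤ δ := by linarith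
  rw [Real.exp_neg, ← div_eq_mul_inv, div_le_iff₀ (Real.exp_pos _)] at h5
  exact (h x hx).trans h5

/-- The potential of the pencil equation. -/
def pencilPotential (p q : ℝ → ℂ) (ρ : ℂ) (x : ℝ) : ℂ := ρ ^ 2 + ρ * p x + q x

/-- The coefficient of the jump condition. -/
def jumpCoeff (η' η : ℕ → ℂ) (ρ : ℂ) (j : ℕ) : ℂ := Complex.I * ρ * η' j + η j

/-- A solution of `z'' + Q z = 0` with jumps at the interior nodes, given by its pieces `z j` on the
closed intervals `[b j, b (j + 1)]`. -/
structure PieceSol (N : ℕ) (b : ℕ → ℝ) (Q : ℝ → ℂ) (γ σ : ℕ → ℂ) (z z' : ℕ → ℝ → ℂ) : Prop where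
  prim : ∀ j < N, IsPrimitiveOn (z j) (z' j) (b j) (b (j + 1))
  prim' : ∀ j < N, IsPrimitiveOn (z' j) (fun x => -(Q x * z j x)) (b j) (b (j + 1))
  jump : ∀ j, j + 1 < N → z (j + 1) (b (j + 1)) = γ (j + 1) * z j (b (j + 1))
  jump' : ∀ j, j + 1 < N →
    z' (j + 1) (b (j + 1)) = (γ (j + 1))⁻¹ * z' j (b (j + 1)) + σ (j + 1) * z j (b (j + 1))

theorem node_le_node {N : ℕ} {b : ℕ → ℝ} (hb : ∀ j < N, b j < b (j + 1)) {i j : ℕ} (hij : i ≤ j)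
    (hj : j ≤ N) : b i ≤ b j := by
  induction j, hij using Nat.le_induction with
  | base => exact le_rfl
  | succ k _ ih => exact (ih (by omega)).trans (hb k (by omega)).le

theorem node_Icc_subset {N : ℕ} {b : ℕ → ℝ} (hb : ∀ j < N, b j < b (j + 1)) {j : ℕ} (hj : j < N) :
    Icc (b j) (b (j + 1)) ⊆ Icc (b 0) (b N) :=
  Icc_subset_Icc (node_le_node hb (Nat.zero_le _) hj.le) (node_le_node hb hj le_rfl)

theorem IntervalIntegrable.node {E : Type*} [NormedAddCommGroup E] {f : ℝ → E} {N : ℕ} {b : ℕ → ℝ}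
    (hf : IntervalIntegrable f volume (b 0) (b N))
    (hb : ∀ j < N, b j < b (j + 1)) {j : ℕ} (hj : j < N) :
    IntervalIntegrable f volume (b j) (b (j + 1)) := by
  refine hf.mono_set ?_
  rw [uIcc_of_le (node_le_node hb (Nat.zero_le N) le_rfl), uIcc_of_le (hb j hj).le]
  exact node_Icc_subset hb hj

theorem IsPrimitiveOn.node {E : Type*} [NormedAddCommGroup E] [NormedSpace ℝ E] {f f' : ℝ → E}
    {N : ℕ} {b : ℕ → ℝ} (hf : IsPrimitiveOn f f' (b 0) (b N))
    (hb : ∀ j < N, b j < b (j + 1)) {j : ℕ} (hj : j < N) :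
    IsPrimitiveOn f f' (b j) (b (j + 1)) :=
  hf.mono (node_Icc_subset hb hj ⟨le_rfl, (hb j hj).le⟩) (node_Icc_subset hb hj ⟨(hb j hj).le, le_rfl⟩)

theorem intervalIntegrable_pencilPotential {p q : ℝ → ℂ} {c d : ℝ} (hcd : c ≤ d)
    (hp : ContinuousOn p (Icc c d)) (hq : IntervalIntegrable q volume c d) (ρ : ℂ) :
    IntervalIntegrable (pencilPotential p q ρ) volume c d := by
  have : IntervalIntegrable p volume c d :=
    ContinuousOn.intervalIntegrable (by rwa [uIcc_of_le hcd])
  exact (intervalIntegrable_const.add (this.const_mul ρ)).add hq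

section Extension

variable {c d : ℝ} {l r : ℂ} {f : ℝ → ℂ}

/-- `f` on `(c, d)`, extended by `l` to the left and by `r` to the right. -/
def extendEnds (f : ℝ → ℂ) (c d : ℝ) (l r : ℂ) (x : ℝ) : ℂ :=
  if x ≤ c then l else if d ≤ x then r else f x

theorem extendEnds_of_mem {x : ℝ} (hx : x ∈ Ioo c d) : extendEnds f c d l r x = f x := by
  simp [extendEnds, hx.1.not_ge, hx.2.not_ge]

theorem extendEnds_left : extendEnds f c d l r c = l := by simp [extendEnds]

theorem extendEnds_right (hcd : c < d) : extendEnds f c d l r d = r := by simp [extendEnds, hcd]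

theorem continuousOn_extendEnds (hcd : c < d) (hf : ContinuousOn f (Ioo c d))
    (hl : Tendsto f (𝓝[>] c) (𝓝 l)) (hr : Tendsto f (𝓝[<] d) (𝓝 r)) :
    ContinuousOn (extendEnds f c d l r) (Icc c d) := by
  refine (continuousOn_Icc_extendFrom_Ioo hf hl hr).congr fun x hx => ?_
  rcases eq_or_lt_of_le hx.1 with rfl | h1
  · rw [extendEnds_left, eq_lim_at_left_extendFrom_Ioo hcd hl]
  rcases eq_or_lt_of_le hx.2 with rfl | h2
  · rw [extendEnds_right hcd, eq_lim_at_right_extendFrom_Ioo hcd hr]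
  rw [extendEnds_of_mem ⟨h1, h2⟩, 
    extendFrom_extends hf x ⟨h1, h2⟩]

end Extension

theorem PencilSolOn.isPrimitiveOn {p q : ℝ → ℂ} {ρ : ℂ} {y y' : ℝ → ℂ} {c d : ℝ} {l r l' r' : ℂ}
    (hcd : c < d) (hp : ContinuousOn p (Icc c d)) (hq : IntervalIntegrable q volume c d)
    (h : PencilSolOn p q ρ y y' c d)
    (hl : Tendsto y (𝓝[>] c) (𝓝 l)) (hr : Tendsto y (𝓝[<] d) (𝓝 r))
    (hl' : Tendsto y' (𝓝[>] c) (𝓝 l')) (hr' : Tendsto y' (𝓝[<] d) (𝓝 r')) :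
    IsPrimitiveOn (extendEnds y c d l r) (extendEnds y' c d l' r') c d ∧
    IsPrimitiveOn (extendEnds y' c d l' r')
      (fun x => -(pencilPotential p q ρ x * extendEnds y c d l r x)) c d := by
  have hQ := intervalIntegrable_pencilPotential hcd.le hp hq ρ
  have hyc : ContinuousOn y (Ioo c d) := fun x hx => (h.1 x hx).continuousAt.continuousWithinAt
  have hz := continuousOn_extendEnds hcd hyc hl hr
  set z := extendEnds y c d l r with hzdef
  have hInt : IntervalIntegrable (fun x => -(pencilPotential p q ρ x * z x)) volume c d :=
    (hQ.mul_continuousOn (by rwa [uIcc_of_le hcd.le])).neg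
  set m := (c + d) / 2
  have hm : m ∈ Ioo c d := ⟨by simp only [m]; linarith, by simp only [m]; linarith⟩
  set H : ℝ → ℂ := fun x => (y' m - ∫ t in c..m, -(pencilPotential p q ρ t * z t)) +
    ∫ t in c..x, -(pencilPotential p q ρ t * z t) with hH
  have hHp : IsPrimitiveOn H (fun x => -(pencilPotential p q ρ x * z x)) c d :=
    ⟨hInt, fun x _ => by simp [hH]⟩
  have heq : ∀ x ∈ Ioo c d, y' x = H x := fun x hx => by
    have e := h.2 m hm x hx
    have e2 : ∫ t in m..x, -((ρ ^ 2 + ρ * p t + q t) * y t) =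
        ∫ t in m..x, -(pencilPotential p q ρ t * z t) := by
      refine intervalIntegral.integral_congr fun t ht => ?_
      have : t ∈ Ioo c d := (ordConnected_Ioo.uIcc_subset hm hx) ht
      simp only [hzdef, extendEnds_of_mem this, pencilPotential]
    have e3 := hHp.sub_eq (Ioo_subset_Icc_self hm) (Ioo_subset_Icc_self hx)
    have e4 : H m = y' m := by simp [hH]
    rw [e2, ← e3, e4] at e
    linear_combination e
  have hHc := hHp.continuousOn hcd.le
  have hyc' : ContinuousOn y' (Ioo c d) :=
    (hHc.mono Ioo_subset_Icc_self).congr heq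
  have hz' := continuousOn_extendEnds hcd hyc' hl' hr'
  have heq' : EqOn (extendEnds y' c d l' r') H (Icc c d) := by
    refine EqOn.of_subset_closure (s := Ioo c d) (fun x hx => ?_) hz' hHc Ioo_subset_Icc_self ?_
    · rw [extendEnds_of_mem hx, heq x hx]
    · rw [closure_Ioo hcd.ne]
  refine ⟨IsPrimitiveOn.of_hasDerivAt hz (fun x hx => ?_)
    (ContinuousOn.intervalIntegrable (by rwa [uIcc_of_le hcd.le])), ?_⟩
  · rw [extendEnds_of_mem hx]
    refine (h.1 x hx).congr_of_eventuallyEq ?_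
    filter_upwards [Ioo_mem_nhds hx.1 hx.2] with t ht using extendEnds_of_mem ht
  · exact hHp.congr hcd.le (fun x hx => (heq' hx).symm) fun _ _ => rfl

namespace JumpSolution

variable {N : ℕ} {b : ℕ → ℝ} {p q : ℝ → ℂ} {γ η' η : ℕ → ℂ} {ρ : ℂ}

/-- The pieces of a solution with jumps on the closed intervals between the nodes. -/
def piece (Y : JumpSolution N b p q γ η' η ρ) (j : ℕ) : ℝ → ℂ :=
  extendEnds Y.y (b j) (b (j + 1)) (Y.yR j) (Y.yL (j + 1))

/-- The derivatives of the pieces of a solution with jumps. -/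
def piece' (Y : JumpSolution N b p q γ η' η ρ) (j : ℕ) : ℝ → ℂ :=
  extendEnds Y.y' (b j) (b (j + 1)) (Y.yR' j) (Y.yL' (j + 1))

theorem pieceSol (Y : JumpSolution N b p q γ η' η ρ) (hb : ∀ j < N, b j < b (j + 1))
    (hp : ContinuousOn p (Icc (b 0) (b N))) (hq : IntervalIntegrable q volume (b 0) (b N)) :
    PieceSol N b (pencilPotential p q ρ) γ (jumpCoeff η' η ρ) Y.piece Y.piece' := by
  have key : ∀ j < N, _ := fun j hj => PencilSolOn.isPrimitiveOn (hb j hj)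
    (hp.mono (node_Icc_subset hb hj)) (hq.node hb hj) (Y.solves (j + 1) (by omega) hj)
    (Y.limR j hj).1 (Y.limL (j + 1) (by omega) hj).1 (Y.limR j hj).2
    (Y.limL (j + 1) (by omega) hj).2
  refine ⟨fun j hj => (key j hj).1, fun j hj => (key j hj).2, fun j hj => ?_, fun j hj => ?_⟩
  · simp only [piece, extendEnds_left, extendEnds_right (hb j (by omega))]
    exact (Y.jump (j + 1) (by omega) (by omega)).1
  · simp only [piece, piece', extendEnds_left, extendEnds_right (hb j (by omega))]
    exact (Y.jump (j + 1) (by omega) (by omega)).2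

theorem piece_zero (Y : JumpSolution N b p q γ η' η ρ) : Y.piece 0 (b 0) = Y.yR 0 :=
  extendEnds_left

theorem piece'_zero (Y : JumpSolution N b p q γ η' η ρ) : Y.piece' 0 (b 0) = Y.yR' 0 :=
  extendEnds_left

theorem piece_last (Y : JumpSolution N b p q γ η' η ρ) (hb : ∀ j < N, b j < b (j + 1))
    (hN : 1 ≤ N) : Y.piece (N - 1) (b N) = Y.yL N := by
  obtain ⟨n, rfl⟩ : ∃ n, N = n + 1 := ⟨N - 1, by omega⟩
  exact extendEnds_right (hb n (by omega))

end JumpSolution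

namespace PieceSol

variable {N : ℕ} {b : ℕ → ℝ} {Q : ℝ → ℂ} {γ σ : ℕ → ℂ} {z z' w w' : ℕ → ℝ → ℂ}

theorem lin (hz : PieceSol N b Q γ σ z z') (hw : PieceSol N b Q γ σ w w') (α β : ℂ)
    (hb : ∀ j < N, b j < b (j + 1)) :
    PieceSol N b Q γ σ (fun j x => α * z j x + β * w j x) (fun j x => α * z' j x + β * w' j x) := by
  refine ⟨fun j hj => ((hz.prim j hj).const_mul α).add ((hw.prim j hj).const_mul β), fun j hj => ?_,
    fun j hj => ?_, fun j hj => ?_⟩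
  · refine (((hz.prim' j hj).const_mul α).add ((hw.prim' j hj).const_mul β)).congr (hb j hj).le
      (fun _ _ => rfl) fun x _ => ?_
    ring
  · rw [hz.jump j hj, hw.jump j hj]
    ring
  · rw [hz.jump' j hj, hw.jump' j hj]
    ring

theorem continuousOn (hz : PieceSol N b Q γ σ z z') (hb : ∀ j < N, b j < b (j + 1)) {j : ℕ}
    (hj : j < N) : ContinuousOn (z j) (Icc (b j) (b (j + 1))) :=
  (hz.prim j hj).continuousOn (hb j hj).le

theorem continuousOn' (hz : PieceSol N b Q γ σ z z') (hb : ∀ j < N, b j < b (j + 1)) {j : ℕ}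
    (hj : j < N) : ContinuousOn (z' j) (Icc (b j) (b (j + 1))) :=
  (hz.prim' j hj).continuousOn (hb j hj).le

/-- The Wronskian of two solutions is constant. -/
theorem wronskian_eq (hz : PieceSol N b Q γ σ z z') (hw : PieceSol N b Q γ σ w w')
    (hb : ∀ j < N, b j < b (j + 1)) (hγ : ∀ j, 1 ≤ j → j + 1 ≤ N → γ j ≠ 0) {j : ℕ} (hj : j < N) :
    ∀ x ∈ Icc (b j) (b (j + 1)), z j x * w' j x - z' j x * w j x =
      z 0 (b 0) * w' 0 (b 0) - z' 0 (b 0) * w 0 (b 0) := by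
  have key : ∀ j < N, ∀ x ∈ Icc (b j) (b (j + 1)), z j x * w' j x - z' j x * w j x =
      z j (b j) * w' j (b j) - z' j (b j) * w j (b j) := fun j hj x hx => by
    have h1 := (((hz.prim j hj).mul (hb j hj).le (hw.prim' j hj)).sub
      ((hz.prim' j hj).mul (hb j hj).le (hw.prim j hj))).2 x hx
    have h2 : ∀ t, z' j t * w' j t + z j t * -(Q t * w j t) -
        (-(Q t * z j t) * w j t + z' j t * w' j t) = 0 := fun t => by ring
    simpa only [h2, intervalIntegral.integral_zero, add_zero] using h1
  induction j with
  | zero => exact key 0 hj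
  | succ k ih =>
    intro x hx
    rw [key _ hj x hx, ← ih (by omega) (b (k + 1)) ⟨(hb k (by omega)).le, le_rfl⟩, hz.jump k hj,
      hz.jump' k hj, hw.jump k hj, hw.jump' k hj]
    field_simp [hγ (k + 1) (by omega) (by omega)]
    ring

end PieceSol

theorem norm_pencilPotential_le (p q : ℝ → ℂ) (ρ : ℂ) (x : ℝ) :
    ‖pencilPotential p q ρ x‖ ≤ (1 + ‖ρ‖ + (‖p x‖ + ‖q x‖)) * (1 + ‖ρ‖) := by
  have h : ‖pencilPotential p q ρ x‖ ≤ ‖ρ‖ ^ 2 + ‖ρ‖ * ‖p x‖ + ‖q x‖ := by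
    refine (norm_add₃_le).trans ?_
    simp
  have := norm_nonneg ρ
  have := norm_nonneg (p x)
  have := norm_nonneg (q x)
  nlinarith [mul_nonneg (norm_nonneg ρ) (norm_nonneg (q x))]

/-- Growth of solutions of the pencil equation on an interval. -/
theorem pencil_growth {p q z z' : ℝ → ℂ} {c d : ℝ} {ρ : ℂ} (hcd : c ≤ d)
    (hp : ContinuousOn p (Icc c d)) (hq : IntervalIntegrable q volume c d)
    (hz : IsPrimitiveOn z z' c d)
    (hz' : IsPrimitiveOn z' (fun x => -(pencilPotential p q ρ x * z x)) c d)
    {x : ℝ} (hx : x ∈ Icc c d) :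
    (1 + ‖ρ‖) * ‖z x‖ + ‖z' x‖ ≤ ((1 + ‖ρ‖) * ‖z c‖ + ‖z' c‖) *
      Real.exp ((1 + ‖ρ‖) * (d - c) + ∫ t in c..d, (‖p t‖ + ‖q t‖)) := by
  set R : ℝ := 1 + ‖ρ‖ with hR
  have hR1 : 0 ≤ R := by positivity
  have hpi : IntervalIntegrable p volume c d :=
    ContinuousOn.intervalIntegrable (by rwa [uIcc_of_le hcd])
  have hpq : IntervalIntegrable (fun t => ‖p t‖ + ‖q t‖) volume c d := hpi.norm.add hq.norm
  have hzc := hz.continuousOn hcd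
  have hzc' := hz'.continuousOn hcd
  have hmc : ContinuousOn (fun t => R * ‖z t‖ + ‖z' t‖) (Icc c d) :=
    (continuousOn_const.mul hzc.norm).add hzc'.norm
  have ha : IntervalIntegrable (fun t => R + (‖p t‖ + ‖q t‖)) volume c d :=
    intervalIntegrable_const.add hpq
  have hc : c ∈ Icc c d := ⟨le_rfl, hcd⟩
  have key := gronwall_integrable (m := fun t => R * ‖z t‖ + ‖z' t‖)
    (a := fun t => R + (‖p t‖ + ‖q t‖)) (δ := R * ‖z c‖ + ‖z' c‖) hcd hmc ha
    (fun t _ => by positivity) (fun y hy => ?_) hx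
  · refine key.trans ?_
    gcongr
    have h1 : IntervalIntegrable (fun t => ‖p t‖ + ‖q t‖) volume c x := by
      refine hpq.mono_set ?_
      rw [uIcc_of_le hcd, uIcc_of_le hx.1]
      exact Icc_subset_Icc le_rfl hx.2
    rw [intervalIntegral.integral_add intervalIntegrable_const h1, intervalIntegral.integral_const,
      smul_eq_mul, mul_comm]
    have h2 : ∫ t in c..x, (‖p t‖ + ‖q t‖) ≤ ∫ t in c..d, (‖p t‖ + ‖q t‖) :=
      intervalIntegral.integral_mono_interval le_rfl hx.1 hx.2
        (Eventually.of_forall fun t => by positivity) hpq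
    have h3 : R * (x - c) ≤ R * (d - c) := by gcongr; exact hx.2
    linarith
  · have i1 : IntervalIntegrable (fun t => R * ‖z' t‖) volume c y :=
      (hz.intervalIntegrable_sub hc hy).norm.const_mul R
    have i2 : IntervalIntegrable (fun t => ‖-(pencilPotential p q ρ t * z t)‖) volume c y :=
      (hz'.intervalIntegrable_sub hc hy).norm
    have hsub : uIcc c y ⊆ uIcc c d := by
      rw [uIcc_of_le hcd, uIcc_of_le hy.1]; exact Icc_subset_Icc le_rfl hy.2
    have i3 : IntervalIntegrable (fun t => (R + (‖p t‖ + ‖q t‖)) * (R * ‖z t‖ + ‖z' t‖))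
        volume c y := (ha.mul_continuousOn (by rwa [uIcc_of_le hcd])).mono_set hsub
    have e1 : R * ‖z y‖ ≤ R * ‖z c‖ + ∫ t in c..y, R * ‖z' t‖ := by
      rw [intervalIntegral.integral_const_mul, ← mul_add, hz.2 y hy]
      gcongr
      exact (norm_add_le _ _).trans (by
        gcongr; exact intervalIntegral.norm_integral_le_integral_norm hy.1)
    have e2 : ‖z' y‖ ≤ ‖z' c‖ + ∫ t in c..y, ‖-(pencilPotential p q ρ t * z t)‖ := by
      rw [hz'.2 y hy]
      exact (norm_add_le _ _).trans (by
        gcongr; exact intervalIntegral.norm_integral_le_integral_norm hy.1)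
    have e3 : (∫ t in c..y, R * ‖z' t‖) + ∫ t in c..y, ‖-(pencilPotential p q ρ t * z t)‖ ≤
        ∫ t in c..y, (R + (‖p t‖ + ‖q t‖)) * (R * ‖z t‖ + ‖z' t‖) := by
      rw [← intervalIntegral.integral_add i1 i2]
      refine intervalIntegral.integral_mono_on hy.1 (i1.add i2) i3 fun t _ => ?_
      rw [norm_neg, norm_mul]
      have h4 := mul_le_mul_of_nonneg_right (norm_pencilPotential_le p q ρ t) (norm_nonneg (z t))
      rw [← hR] at h4
      have h5 : 0 ≤ (‖p t‖ + ‖q t‖) * ‖z' t‖ := by positivity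
      nlinarith
    linarith

namespace PieceSol

variable {N : ℕ} {b : ℕ → ℝ} {p q : ℝ → ℂ} {γ η' η : ℕ → ℂ}

/-- Solutions with jumps grow at most exponentially in the spectral parameter. -/
theorem growth (hb : ∀ j < N, b j < b (j + 1)) (hp : ContinuousOn p (Icc (b 0) (b N)))
    (hq : IntervalIntegrable q volume (b 0) (b N)) {j : ℕ} (hj : j < N) :
    ∃ K B : ℝ, 0 ≤ K ∧ 0 ≤ B ∧ ∀ (ρ : ℂ) (z z' : ℕ → ℝ → ℂ),
      PieceSol N b (pencilPotential p q ρ) γ (jumpCoeff η' η ρ) z z' →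
      ∀ x ∈ Icc (b j) (b (j + 1)), (1 + ‖ρ‖) * ‖z j x‖ + ‖z' j x‖ ≤
        ((1 + ‖ρ‖) * ‖z 0 (b 0)‖ + ‖z' 0 (b 0)‖) * (K * Real.exp (B * (1 + ‖ρ‖))) := by
  have step : ∀ j < N, ∀ (ρ : ℂ) (z z' : ℕ → ℝ → ℂ),
      PieceSol N b (pencilPotential p q ρ) γ (jumpCoeff η' η ρ) z z' →
      ∀ x ∈ Icc (b j) (b (j + 1)), (1 + ‖ρ‖) * ‖z j x‖ + ‖z' j x‖ ≤
        ((1 + ‖ρ‖) * ‖z j (b j)‖ + ‖z' j (b j)‖) *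
        (Real.exp (∫ t in b j..b (j + 1), (‖p t‖ + ‖q t‖)) *
          Real.exp ((b (j + 1) - b j) * (1 + ‖ρ‖))) := fun j hj ρ z z' hz x hx => by
    refine (pencil_growth (hb j hj).le (hp.mono (node_Icc_subset hb hj)) (hq.node hb hj)
      (hz.prim j hj) (hz.prim' j hj) hx).trans_eq ?_
    rw [Real.exp_add, mul_comm (1 + ‖ρ‖) (b (j + 1) - b j)]
    ring
  induction j with
  | zero => exact ⟨_, _, (Real.exp_pos _).le, by linarith [hb 0 hj], step 0 hj⟩
  | succ k ih =>
    obtain ⟨K, B, hK, hB, H⟩ := ih (by omega)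
    set E := Real.exp (∫ t in b (k + 1)..b (k + 1 + 1), (‖p t‖ + ‖q t‖))
    set L := ‖γ (k + 1)‖ + ‖(γ (k + 1))⁻¹‖ + ‖η' (k + 1)‖ + ‖η (k + 1)‖ with hL
    refine ⟨E * L * K, B + (b (k + 1 + 1) - b (k + 1)), by positivity,
      by linarith [hb (k + 1) hj], fun ρ z z' hz x hx => ?_⟩
    refine (step (k + 1) hj ρ z z' hz x hx).trans ?_
    have h1 := H ρ z z' hz (b (k + 1)) ⟨(hb k (by omega)).le, le_rfl⟩
    have h2 : (1 + ‖ρ‖) * ‖z (k + 1) (b (k + 1))‖ + ‖z' (k + 1) (b (k + 1))‖ ≤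
        L * ((1 + ‖ρ‖) * ‖z k (b (k + 1))‖ + ‖z' k (b (k + 1))‖) := by
      rw [hz.jump k hj, hz.jump' k hj, norm_mul]
      have h3 := norm_add_le ((γ (k + 1))⁻¹ * z' k (b (k + 1)))
        (jumpCoeff η' η ρ (k + 1) * z k (b (k + 1)))
      have h4 : ‖jumpCoeff η' η ρ (k + 1)‖ ≤ ‖ρ‖ * ‖η' (k + 1)‖ + ‖η (k + 1)‖ := by
        refine (norm_add_le _ _).trans ?_
        simp
      rw [norm_mul, norm_mul] at h3
      have h5 := mul_le_mul_of_nonneg_right h4 (norm_nonneg (z k (b (k + 1))))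
      have a1 := norm_nonneg ρ
      have a2 := norm_nonneg (z k (b (k + 1)))
      have a3 := norm_nonneg (z' k (b (k + 1)))
      have a4 := norm_nonneg (γ (k + 1))
      have a5 := norm_nonneg ((γ (k + 1))⁻¹)
      have a6 := norm_nonneg (η' (k + 1))
      have a7 := norm_nonneg (η (k + 1))
      generalize ‖γ (k + 1)‖ = g1 at *
      generalize ‖(γ (k + 1))⁻¹‖ = g2 at *
      generalize ‖η' (k + 1)‖ = g3 at *
      generalize ‖η (k + 1)‖ = g4 at *
      generalize ‖z k (b (k + 1))‖ = y at *
      generalize ‖z' k (b (k + 1))‖ = y' at *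
      generalize ‖ρ‖ = r at *
      have m1 : 0 ≤ g1 * y' := by positivity
      have m2 : 0 ≤ g2 * ((1 + r) * y) := by positivity
      have m3 : 0 ≤ g3 * y + g3 * y' := by positivity
      have m4 : 0 ≤ g4 * (r * y) + g4 * y' := by positivity
      rw [hL]
      nlinarith
    rw [add_mul B, Real.exp_add]
    calc _ ≤ (L * (((1 + ‖ρ‖) * ‖z 0 (b 0)‖ + ‖z' 0 (b 0)‖) * (K * Real.exp (B * (1 + ‖ρ‖))))) *
        (E * Real.exp ((b (k + 1 + 1) - b (k + 1)) * (1 + ‖ρ‖))) := by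
          gcongr
          exact h2.trans (by gcongr)
      _ = _ := by ring

end PieceSol

/-- A function `(ρ - ρ₀) K(ρ)` with `K` continuous at `ρ₀` is differentiable at `ρ₀`. -/
theorem ContinuousAt.differentiableAt_sub_mul {K : ℂ → ℂ} {ρ₀ : ℂ} (hK : ContinuousAt K ρ₀) :
    DifferentiableAt ℂ (fun ρ => (ρ - ρ₀) * K ρ) ρ₀ := by
  refine HasDerivAt.differentiableAt (f' := K ρ₀) ?_
  rw [hasDerivAt_iff_tendsto_slope]
  refine (hK.tendsto.mono_left nhdsWithin_le_nhds).congr' ?_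
  filter_upwards [self_mem_nhdsWithin] with ρ hρ
  have : ρ - ρ₀ ≠ 0 := sub_ne_zero.2 hρ
  simp [slope_def_field, this]

section Interval

variable {p q : ℝ → ℂ} {c d : ℝ} {ρ₀ : ℂ}

/-- Lagrange's identity for solutions belonging to two spectral parameters. -/
theorem pencil_lagrange {ρ : ℂ} {f f' z z' : ℝ → ℂ} (hcd : c ≤ d)
    (hf : IsPrimitiveOn f f' c d)
    (hf' : IsPrimitiveOn f' (fun x => -(pencilPotential p q ρ₀ x * f x)) c d)
    (hz : IsPrimitiveOn z z' c d)
    (hz' : IsPrimitiveOn z' (fun x => -(pencilPotential p q ρ x * z x)) c d)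
    {x : ℝ} (hx : x ∈ Icc c d) :
    f' x * z x - f x * z' x = (f' c * z c - f c * z' c) +
      (ρ - ρ₀) * ∫ t in c..x, (ρ + ρ₀ + p t) * f t * z t := by
  refine (((hf'.mul hcd hz).sub (hf.mul hcd hz')).2 x hx).trans ?_
  rw [← intervalIntegral.integral_const_mul]
  congr 2
  ext t
  simp only [pencilPotential]
  ring

theorem pencil_differentiableAt (hcd : c ≤ d)
    (hp : ContinuousOn p (Icc c d)) (hq : IntervalIntegrable q volume c d)
    {z z' : ℂ → ℝ → ℂ} (hz : ∀ ρ, IsPrimitiveOn (z ρ) (z' ρ) c d)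
    (hz' : ∀ ρ, IsPrimitiveOn (z' ρ) (fun x => -(pencilPotential p q ρ x * z ρ x)) c d)
    {u u' w w' : ℝ → ℂ} (hu : IsPrimitiveOn u u' c d)
    (hu' : IsPrimitiveOn u' (fun x => -(pencilPotential p q ρ₀ x * u x)) c d)
    (hw : IsPrimitiveOn w w' c d)
    (hw' : IsPrimitiveOn w' (fun x => -(pencilPotential p q ρ₀ x * w x)) c d)
    (hW : ∀ x ∈ Icc c d, u x * w' x - u' x * w x = 1)
    (hd : DifferentiableAt ℂ (fun ρ => z ρ c) ρ₀) (hd' : DifferentiableAt ℂ (fun ρ => z' ρ c) ρ₀)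
    {x : ℝ} (hx : x ∈ Icc c d) :
    DifferentiableAt ℂ (fun ρ => z ρ x) ρ₀ ∧ DifferentiableAt ℂ (fun ρ => z' ρ x) ρ₀ := by
  -- local bound of the family
  have hbound : ∃ B, ∀ᶠ ρ in 𝓝 ρ₀, ∀ t ∈ Icc c d, ‖z ρ t‖ ≤ B := by
    set G : ℂ → ℝ := fun ρ => ((1 + ‖ρ‖) * ‖z ρ c‖ + ‖z' ρ c‖) *
      Real.exp ((1 + ‖ρ‖) * (d - c) + ∫ t in c..d, (‖p t‖ + ‖q t‖)) with hG
    have hGc : ContinuousAt G ρ₀ := by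
      have h1 := hd.continuousAt
      have h2 := hd'.continuousAt
      simp only [hG]
      fun_prop
    refine ⟨G ρ₀ + 1, ?_⟩
    filter_upwards [hGc.eventually (gt_mem_nhds (lt_add_one (G ρ₀)))] with ρ hρ t ht
    have h3 := pencil_growth hcd hp hq (hz ρ) (hz' ρ) ht
    have h4 : 0 ≤ ‖ρ‖ * ‖z ρ t‖ := by positivity
    have h5 := norm_nonneg (z' ρ t)
    simp only [hG] at hρ ⊢
    linarith
  obtain ⟨B, hB⟩ := hbound
  have hInt : ∀ f : ℝ → ℂ, ContinuousOn f (Icc c d) →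
      ∃ M, ∀ᶠ ρ in 𝓝 ρ₀, ∀ t ∈ Icc c d, ‖(ρ + ρ₀ + p t) * f t * z ρ t‖ ≤ M := by
    intro f hf
    obtain ⟨P, hP⟩ := isCompact_Icc.exists_bound_of_continuousOn hp
    obtain ⟨F, hF⟩ := isCompact_Icc.exists_bound_of_continuousOn hf
    refine ⟨(‖ρ₀‖ + 1 + ‖ρ₀‖ + P) * F * B, ?_⟩
    have h1 : ∀ᶠ ρ : ℂ in 𝓝 ρ₀, ‖ρ‖ < ‖ρ₀‖ + 1 :=
      continuous_norm.continuousAt.eventually (gt_mem_nhds (lt_add_one _))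
    filter_upwards [hB, h1] with ρ h2 h3 t ht
    rw [norm_mul, norm_mul]
    have h4 : ‖ρ + ρ₀ + p t‖ ≤ ‖ρ₀‖ + 1 + ‖ρ₀‖ + P := by
      refine norm_add₃_le.trans ?_
      linarith [hP t ht]
    have := hP t ht
    have := hF t ht
    have := h2 t ht
    have h0 : 0 ≤ F := (norm_nonneg _).trans (hF t ht)
    have h00 := (norm_nonneg _).trans h4
    gcongr
  have hcont : ∀ f f' : ℝ → ℂ, IsPrimitiveOn f f' c d →
      IsPrimitiveOn f' (fun x => -(pencilPotential p q ρ₀ x * f x)) c d → ∀ t ∈ Icc c d,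
      ContinuousAt (fun ρ => f' t * z ρ t - f t * z' ρ t) ρ₀ := by
    intro f f' hf hf' t ht
    have e : (fun ρ => f' t * z ρ t - f t * z' ρ t) = fun ρ => (f' c * z ρ c - f c * z' ρ c) +
        (ρ - ρ₀) * ∫ s in c..t, (ρ + ρ₀ + p s) * f s * z ρ s :=
      funext fun ρ => pencil_lagrange hcd hf hf' (hz ρ) (hz' ρ) ht
    rw [e]
    have h1 := hd.continuousAt
    have h2 := hd'.continuousAt
    refine ContinuousAt.add (by fun_prop) ?_
    obtain ⟨M, hM⟩ := hInt f (hf.continuousOn hcd)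
    have hb : IsBoundedUnder (· ≤ ·) (𝓝 ρ₀)
        ((‖·‖) ∘ fun ρ => ∫ s in c..t, (ρ + ρ₀ + p s) * f s * z ρ s) := by
      refine ⟨M * |t - c|, ?_⟩
      rw [eventually_map]
      filter_upwards [hM] with ρ hρ
      refine intervalIntegral.norm_integral_le_of_norm_le_const fun s hs => hρ s ?_
      rw [uIoc_of_le ht.1] at hs
      exact ⟨hs.1.le, hs.2.trans ht.2⟩
    have h0 : Tendsto (fun ρ => ρ - ρ₀) (𝓝 ρ₀) (𝓝 0) := by
      have : ContinuousAt (fun ρ => ρ - ρ₀) ρ₀ := by fun_prop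
      simpa [ContinuousAt] using this
    have := h0.zero_mul_isBoundedUnder_le hb
    simpa [ContinuousAt] using this
  have hzc : ∀ t ∈ Icc c d, ContinuousAt (fun ρ => z ρ t) ρ₀ := by
    intro t ht
    have h1 := hcont u u' hu hu' t ht
    have h2 := hcont w w' hw hw' t ht
    refine ((h2.mul_const (u t)).sub (h1.mul_const (w t))).congr (Eventually.of_forall fun ρ => ?_)
    simp only [Pi.sub_apply]
    linear_combination (z ρ t) * hW t ht
  have hdiff : ∀ f f' : ℝ → ℂ, IsPrimitiveOn f f' c d →
      IsPrimitiveOn f' (fun x => -(pencilPotential p q ρ₀ x * f x)) c d →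
      DifferentiableAt ℂ (fun ρ => f' x * z ρ x - f x * z' ρ x) ρ₀ := by
    intro f f' hf hf'
    have e : (fun ρ => f' x * z ρ x - f x * z' ρ x) = fun ρ => (f' c * z ρ c - f c * z' ρ c) +
        (ρ - ρ₀) * ∫ s in c..x, (ρ + ρ₀ + p s) * f s * z ρ s :=
      funext fun ρ => pencil_lagrange hcd hf hf' (hz ρ) (hz' ρ) hx
    rw [e]
    refine ((hd.const_mul _).sub (hd'.const_mul _)).add
      (ContinuousAt.differentiableAt_sub_mul ?_)
    obtain ⟨M, hM⟩ := hInt f (hf.continuousOn hcd)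
    have hsub : ∀ s, s ∈ uIoc c x → s ∈ Icc c d := fun s hs => by
      rw [uIoc_of_le hx.1] at hs
      exact ⟨hs.1.le, hs.2.trans hx.2⟩
    refine intervalIntegral.continuousAt_of_dominated_interval (bound := fun _ => M)
      (Eventually.of_forall fun ρ => ?_) ?_ intervalIntegrable_const ?_
    · have h1 : ContinuousOn (fun s => (ρ + ρ₀ + p s) * f s * z ρ s) (uIoc c x) :=
        (((continuousOn_const.add hp).mul (hf.continuousOn hcd)).mul
          ((hz ρ).continuousOn hcd)).mono hsub
      exact h1.aestronglyMeasurable measurableSet_uIoc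
    · filter_upwards [hM] with ρ hρ
      exact Eventually.of_forall fun s hs => hρ s (hsub s hs)
    · refine Eventually.of_forall fun s hs => ?_
      have := hzc s (hsub s hs)
      fun_prop
  have h1 := hdiff u u' hu hu'
  have h2 := hdiff w w' hw hw'
  constructor
  · refine ((h2.mul_const (u x)).sub (h1.mul_const (w x))).congr_of_eventuallyEq
      (Eventually.of_forall fun ρ => ?_)
    simp only [Pi.sub_apply]
    linear_combination -(z ρ x) * hW x hx
  · refine ((h2.mul_const (u' x)).sub (h1.mul_const (w' x))).congr_of_eventuallyEq
      (Eventually.of_forall fun ρ => ?_)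
    simp only [Pi.sub_apply]
    linear_combination -(z' ρ x) * hW x hx

end Interval

namespace PieceSol

variable {N : ℕ} {b : ℕ → ℝ} {p q : ℝ → ℂ} {γ η' η : ℕ → ℂ}

/-- A family of solutions with entire initial data is entire in the spectral parameter, provided a
fundamental system with unit Wronskian exists. -/
theorem differentiable (hb : ∀ j < N, b j < b (j + 1)) (hγ : ∀ j, 1 ≤ j → j + 1 ≤ N → γ j ≠ 0)
    (hp : ContinuousOn p (Icc (b 0) (b N)))
    (hq : IntervalIntegrable q volume (b 0) (b N)) {z z' u u' w w' : ℂ → ℕ → ℝ → ℂ}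
    (hz : ∀ ρ, PieceSol N b (pencilPotential p q ρ) γ (jumpCoeff η' η ρ) (z ρ) (z' ρ))
    (hu : ∀ ρ, PieceSol N b (pencilPotential p q ρ) γ (jumpCoeff η' η ρ) (u ρ) (u' ρ))
    (hw : ∀ ρ, PieceSol N b (pencilPotential p q ρ) γ (jumpCoeff η' η ρ) (w ρ) (w' ρ))
    (hW : ∀ ρ, u ρ 0 (b 0) * w' ρ 0 (b 0) - u' ρ 0 (b 0) * w ρ 0 (b 0) = 1)
    (hd : Differentiable ℂ fun ρ => z ρ 0 (b 0)) (hd' : Differentiable ℂ fun ρ => z' ρ 0 (b 0))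
    {j : ℕ} (hj : j < N) : ∀ x ∈ Icc (b j) (b (j + 1)),
      (Differentiable ℂ fun ρ => z ρ j x) ∧ Differentiable ℂ fun ρ => z' ρ j x := by
  have step : ∀ j < N, (Differentiable ℂ fun ρ => z ρ j (b j)) →
      (Differentiable ℂ fun ρ => z' ρ j (b j)) → ∀ x ∈ Icc (b j) (b (j + 1)),
      (Differentiable ℂ fun ρ => z ρ j x) ∧ Differentiable ℂ fun ρ => z' ρ j x := by
    intro j hj h1 h2 x hx
    have key := fun ρ₀ => pencil_differentiableAt (ρ₀ := ρ₀) (hb j hj).le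
      (hp.mono (node_Icc_subset hb hj))
      (hq.node hb hj) (z := fun ρ => z ρ j) (z' := fun ρ => z' ρ j) (fun ρ => (hz ρ).prim j hj)
      (fun ρ => (hz ρ).prim' j hj) ((hu ρ₀).prim j hj) ((hu ρ₀).prim' j hj)
      ((hw ρ₀).prim j hj) ((hw ρ₀).prim' j hj)
      (fun y hy => ((hu ρ₀).wronskian_eq (hw ρ₀) hb hγ hj y hy).trans (hW ρ₀)) (h1 ρ₀) (h2 ρ₀) hx
    exact ⟨fun ρ₀ => (key ρ₀).1, fun ρ₀ => (key ρ₀).2⟩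
  induction j with
  | zero => exact step 0 hj hd hd'
  | succ k ih =>
    obtain ⟨h1, h2⟩ := ih (by omega) (b (k + 1)) ⟨(hb k (by omega)).le, le_rfl⟩
    refine step (k + 1) hj ?_ ?_
    · simp only [fun ρ => (hz ρ).jump k hj]
      exact h1.const_mul _
    · simp only [fun ρ => (hz ρ).jump' k hj]
      refine (h2.const_mul _).add (Differentiable.mul ?_ h1)
      unfold jumpCoeff
      fun_prop

end PieceSol

section WKB

variable {p p' q z z' : ℝ → ℂ} {a : ℝ → ℝ} {c d κ : ℝ} {ρ : ℂ}

/-- The wave number `ρ + p / 2` of the pencil equation. -/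
def waveNumber (p : ℝ → ℂ) (ρ : ℂ) (x : ℝ) : ℂ := ρ + p x / 2

/-- The component `z' - i k z` of a solution, with `k` the wave number. -/
def waveMinus (p : ℝ → ℂ) (ρ : ℂ) (z z' : ℝ → ℂ) (x : ℝ) : ℂ :=
  z' x - Complex.I * waveNumber p ρ x * z x

/-- The component `z' + i k z` of a solution, with `k` the wave number. -/
def wavePlus (p : ℝ → ℂ) (ρ : ℂ) (z z' : ℝ → ℂ) (x : ℝ) : ℂ :=
  z' x + Complex.I * waveNumber p ρ x * z x

/-- The phase `∫ k` of the pencil equation. -/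
def phase (p : ℝ → ℂ) (ρ : ℂ) (c x : ℝ) : ℂ := ∫ t in c..x, waveNumber p ρ t

theorem norm_exp_I_mul_phase (x : ℝ) :
    ‖Complex.exp (Complex.I * phase p ρ c x)‖ = Real.exp (-(phase p ρ c x).im) := by
  rw [Complex.norm_exp]; simp

theorem isPrimitiveOn_waveNumber (hp : IsPrimitiveOn p p' c d) :
    IsPrimitiveOn (waveNumber p ρ) (fun x => p' x / 2) c d := by
  have h := (IsPrimitiveOn.const (c := c) (d := d) ρ).add (hp.const_mul 2⁻¹)
  refine ⟨?_, fun x hx => ?_⟩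
  · simpa only [zero_add, div_eq_inv_mul] using h.1
  · have := h.2 x hx
    simpa only [zero_add, div_eq_inv_mul, waveNumber] using this

theorem isPrimitiveOn_phase (hcd : c ≤ d) (hp : IsPrimitiveOn p p' c d) :
    IsPrimitiveOn (phase p ρ c) (waveNumber p ρ) c d := by
  refine ⟨ContinuousOn.intervalIntegrable ?_, fun x _ => by simp [phase]⟩
  rw [uIcc_of_le hcd]
  exact (isPrimitiveOn_waveNumber hp).continuousOn hcd

theorem phase_im_sub_le (hcd : c ≤ d) (hp : IsPrimitiveOn p p' c d)
    (hκ : ∀ x ∈ Icc c d, κ ≤ (waveNumber p ρ x).im) {s t : ℝ} (hs : s ∈ Icc c d)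
    (ht : t ∈ Icc c d) (hst : s ≤ t) : κ * (t - s) ≤ (phase p ρ c t).im - (phase p ρ c s).im := by
  have h := (isPrimitiveOn_phase (ρ := ρ) hcd hp)
  have hi := h.intervalIntegrable_sub hs ht
  rw [← Complex.sub_im, h.sub_eq hs ht]
  have e : (∫ x in s..t, waveNumber p ρ x).im = ∫ x in s..t, (waveNumber p ρ x).im :=
    (Complex.imCLM.intervalIntegral_comp_comm hi).symm
  have e2 : κ * (t - s) = ∫ x in s..t, κ := by simp [mul_comm]
  rw [e, e2]
  refine intervalIntegral.integral_mono_on hst intervalIntegrable_const ?_ fun x hx =>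
    hκ x ⟨hs.1.trans hx.1, hx.2.trans ht.2⟩
  exact ⟨hi.1.im, hi.2.im⟩

theorem isPrimitiveOn_waveMinus_mul_exp (hcd : c ≤ d) (hp : IsPrimitiveOn p p' c d)
    (hz : IsPrimitiveOn z z' c d)
    (hz' : IsPrimitiveOn z' (fun x => -(pencilPotential p q ρ x * z x)) c d) :
    IsPrimitiveOn (fun x => waveMinus p ρ z z' x * Complex.exp (Complex.I * phase p ρ c x))
      (fun x => (p x ^ 2 / 4 - q x - Complex.I * p' x / 2) *
        (z x * Complex.exp (Complex.I * phase p ρ c x))) c d := by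
  have hk := isPrimitiveOn_waveNumber (ρ := ρ) hp
  refine ((hz'.sub ((hk.const_mul Complex.I).mul hcd hz)).mul hcd
    (((isPrimitiveOn_phase (ρ := ρ) hcd hp).const_mul Complex.I).complexExp hcd)).congr hcd
    (fun _ _ => rfl) fun x _ => ?_
  simp only [pencilPotential, waveNumber]
  ring_nf
  simp only [Complex.I_sq]
  ring

theorem isPrimitiveOn_wavePlus_mul_exp (hcd : c ≤ d) (hp : IsPrimitiveOn p p' c d)
    (hz : IsPrimitiveOn z z' c d)
    (hz' : IsPrimitiveOn z' (fun x => -(pencilPotential p q ρ x * z x)) c d) :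
    IsPrimitiveOn (fun x => wavePlus p ρ z z' x * Complex.exp (-Complex.I * phase p ρ c x))
      (fun x => (p x ^ 2 / 4 - q x + Complex.I * p' x / 2) *
        (z x * Complex.exp (-Complex.I * phase p ρ c x))) c d := by
  have hk := isPrimitiveOn_waveNumber (ρ := ρ) hp
  refine ((hz'.add ((hk.const_mul Complex.I).mul hcd hz)).mul hcd
    (((isPrimitiveOn_phase (ρ := ρ) hcd hp).const_mul (-Complex.I)).complexExp hcd)).congr hcd
    (fun _ _ => rfl) fun x _ => ?_
  simp only [pencilPotential, waveNumber]
  ring_nf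
  simp only [Complex.I_sq]
  ring

/-- Bounds for the two wave components in the upper half plane. -/
theorem wave_estimate (hcd : c ≤ d) (hp : IsPrimitiveOn p p' c d)
    (hz : IsPrimitiveOn z z' c d)
    (hz' : IsPrimitiveOn z' (fun x => -(pencilPotential p q ρ x * z x)) c d)
    (ha : IntervalIntegrable a volume c d)
    (hpa : ∀ x, ‖p x ^ 2 / 4 - q x‖ + ‖p' x‖ ≤ a x)
    (hκ0 : 0 < κ) (hκ : ∀ x ∈ Icc c d, κ ≤ (waveNumber p ρ x).im)
    (hA : ∫ t in c..d, a t ≤ κ) {x : ℝ} (hx : x ∈ Icc c d) :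
    ‖waveMinus p ρ z z' x * Complex.exp (Complex.I * phase p ρ c x) - waveMinus p ρ z z' c‖ ≤
      2 / κ * (∫ t in c..d, a t) * (‖waveMinus p ρ z z' c‖ + ‖wavePlus p ρ z z' c‖) ∧
    ‖wavePlus p ρ z z' x * Complex.exp (Complex.I * phase p ρ c x)‖ ≤
      (Real.exp (-2 * κ * (x - c)) + 2 / κ * ∫ t in c..x, Real.exp (-2 * κ * (x - t)) * a t) *
        (‖waveMinus p ρ z z' c‖ + ‖wavePlus p ρ z z' c‖) := by
  set E : ℝ → ℂ := fun x => Complex.exp (Complex.I * phase p ρ c x) with hE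
  set U : ℝ → ℂ := fun x => waveMinus p ρ z z' x * E x with hU
  set V : ℝ → ℂ := fun x => wavePlus p ρ z z' x * E x with hV
  set mc : ℝ := ‖waveMinus p ρ z z' c‖ + ‖wavePlus p ρ z z' c‖ with hmc
  set m : ℝ → ℝ := fun x => ‖U x‖ + ‖V x‖ with hm
  have hmc0 : 0 ≤ mc := by positivity
  have ha0 : ∀ t, 0 ≤ a t := fun t => le_trans (by positivity) (hpa t)
  have hEc : E c = 1 := by simp [hE, phase]
  have hc : c ∈ Icc c d := ⟨le_rfl, hcd⟩
  have hUp := isPrimitiveOn_waveMinus_mul_exp hcd hp hz hz'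
  have hVp := isPrimitiveOn_wavePlus_mul_exp hcd hp hz hz'
  have hEE : ∀ t, Complex.exp (-Complex.I * phase p ρ c t) * (E t * E t) = E t := fun t => by
    simp only [hE, ← Complex.exp_add]; congr 1; ring
  have hVeq : ∀ t, V t = wavePlus p ρ z z' t * Complex.exp (-Complex.I * phase p ρ c t) *
      (E t * E t) := fun t => by
    rw [mul_assoc, hEE]
  have hEcont : ContinuousOn E (Icc c d) :=
    (continuousOn_const.mul ((isPrimitiveOn_phase hcd hp).continuousOn hcd)).cexp
  have hUcont : ContinuousOn U (Icc c d) := hUp.continuousOn hcd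
  have hVcont : ContinuousOn V (Icc c d) :=
    ((hVp.continuousOn hcd).mul (hEcont.mul hEcont)).congr fun t _ => hVeq t
  have hmcont : ContinuousOn m (Icc c d) := hUcont.norm.add hVcont.norm
  have hzE : ∀ t ∈ Icc c d, ‖z t * E t‖ ≤ m t / (2 * κ) := fun t ht => by
    have e : V t - U t = 2 * Complex.I * waveNumber p ρ t * (z t * E t) := by
      simp only [hV, hU, wavePlus, waveMinus]; ring
    have h1 : ‖V t - U t‖ ≤ m t := by
      refine (norm_sub_le _ _).trans ?_
      simp only [hm]; linarith
    rw [e, norm_mul, norm_mul, norm_mul] at h1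
    simp only [Complex.norm_I, RCLike.norm_ofNat, mul_one] at h1
    have h2 : κ ≤ ‖waveNumber p ρ t‖ := (hκ t ht).trans (Complex.im_le_norm _)
    rw [le_div_iff₀ (by positivity)]
    calc ‖z t * E t‖ * (2 * κ) ≤ ‖z t * E t‖ * (2 * ‖waveNumber p ρ t‖) := by gcongr
      _ ≤ m t := by linarith
  have hh1 : ∀ t, ‖p t ^ 2 / 4 - q t - Complex.I * p' t / 2‖ ≤ a t := fun t => by
    refine ((norm_sub_le _ _).trans ?_).trans (hpa t)
    have : ‖Complex.I * p' t / 2‖ = ‖p' t‖ / 2 := by simp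
    rw [this]; linarith [norm_nonneg (p' t)]
  have hh2 : ∀ t, ‖p t ^ 2 / 4 - q t + Complex.I * p' t / 2‖ ≤ a t := fun t => by
    refine ((norm_add_le _ _).trans ?_).trans (hpa t)
    have : ‖Complex.I * p' t / 2‖ = ‖p' t‖ / 2 := by simp
    rw [this]; linarith [norm_nonneg (p' t)]
  have hsub : ∀ y ∈ Icc c d, uIcc c y ⊆ uIcc c d := fun y hy => by
    rw [uIcc_of_le hcd, uIcc_of_le hy.1]; exact Icc_subset_Icc le_rfl hy.2
  have ham : ∀ y ∈ Icc c d, IntervalIntegrable (fun t => a t * (m t / (2 * κ))) volume c y :=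
    fun y hy => ((ha.mul_continuousOn (by
      rw [uIcc_of_le hcd]; exact hmcont.div_const _)).mono_set (hsub y hy))
  have haem : ∀ y ∈ Icc c d, IntervalIntegrable
      (fun t => Real.exp (-2 * κ * (y - t)) * (a t * (m t / (2 * κ)))) volume c y :=
    fun y hy => (ham y hy).continuousOn_mul (by fun_prop)
  have hUest : ∀ y ∈ Icc c d, ‖U y - U c‖ ≤ ∫ t in c..y, a t * (m t / (2 * κ)) := by
    intro y hy
    rw [hUp.sub_eq hc hy]
    refine intervalIntegral.norm_integral_le_of_norm_le hy.1 (Eventually.of_forall fun t ht => ?_)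
      (ham y hy)
    rw [norm_mul]
    exact mul_le_mul (hh1 t) (hzE t ⟨ht.1.le, ht.2.trans hy.2⟩) (norm_nonneg _) (ha0 t)
  have hVest : ∀ y ∈ Icc c d, ‖V y‖ ≤ Real.exp (-2 * κ * (y - c)) * ‖V c‖ +
      ∫ t in c..y, Real.exp (-2 * κ * (y - t)) * (a t * (m t / (2 * κ))) := by
    intro y hy
    have hnE : ∀ s ∈ Icc c y, ‖E y * E y‖ ≤ Real.exp (-2 * κ * (y - s)) * ‖E s * E s‖ := by
      intro s hs
      have hs' : s ∈ Icc c d := ⟨hs.1, hs.2.trans hy.2⟩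
      rw [norm_mul, norm_mul, hE, norm_exp_I_mul_phase, norm_exp_I_mul_phase, ← Real.exp_add,
        ← Real.exp_add, ← Real.exp_add]
      refine Real.exp_le_exp.2 ?_
      linarith [phase_im_sub_le hcd hp hκ hs' hy hs.2]
    have e := hVp.2 y hy
    beta_reduce at e
    have e0 : wavePlus p ρ z z' c * Complex.exp (-Complex.I * phase p ρ c c) = V c := by
      simp [hV, hE, phase]
    have e1 : V y = E y * E y * V c + ∫ t in c..y, E y * E y * ((p t ^ 2 / 4 - q t +
        Complex.I * p' t / 2) * (z t * Complex.exp (-Complex.I * phase p ρ c t))) := by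
      rw [hVeq, e, e0, intervalIntegral.integral_const_mul]; ring
    rw [e1]
    refine (norm_add_le _ _).trans (add_le_add ?_ ?_)
    · rw [norm_mul]
      have := hnE c ⟨le_rfl, hy.1⟩
      rw [hEc, mul_one, norm_one, mul_one] at this
      gcongr
    · refine intervalIntegral.norm_integral_le_of_norm_le hy.1
        (Eventually.of_forall fun t ht => ?_) (haem y hy)
      have ht' : t ∈ Icc c d := ⟨ht.1.le, ht.2.trans hy.2⟩
      rw [norm_mul (E y * E y), norm_mul (_ + _)]
      calc ‖E y * E y‖ * (‖p t ^ 2 / 4 - q t + Complex.I * p' t / 2‖ *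
            ‖z t * Complex.exp (-Complex.I * phase p ρ c t)‖)
          ≤ (Real.exp (-2 * κ * (y - t)) * ‖E t * E t‖) * (a t *
            ‖z t * Complex.exp (-Complex.I * phase p ρ c t)‖) := by
            gcongr
            · exact hnE t ⟨ht.1.le, ht.2⟩
            · exact hh2 t
        _ = Real.exp (-2 * κ * (y - t)) * (a t * ‖z t * E t‖) := by
            have : ‖z t * E t‖ = ‖z t * Complex.exp (-Complex.I * phase p ρ c t)‖ *
                ‖E t * E t‖ := by rw [← norm_mul, mul_assoc, hEE]
            rw [this]; ring
        _ ≤ _ := by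
            gcongr
            · exact ha0 t
            · exact hzE t ht'
  have hexp : ∀ y t : ℝ, t ≤ y → Real.exp (-2 * κ * (y - t)) ≤ 1 := fun y t hty => by
    rw [Real.exp_le_one_iff]; nlinarith
  have hUc : U c = waveMinus p ρ z z' c := by simp [hU, hEc]
  have hVc : V c = wavePlus p ρ z z' c := by simp [hV, hEc]
  have hm0 : ∀ t, 0 ≤ m t := fun t => by positivity
  have hgr : ∀ y ∈ Icc c d, m y ≤ 3 * mc := by
    intro y hy
    have := gronwall_integrable (m := m) (a := fun t => a t / κ) (δ := mc) hcd hmcont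
      (ha.div_const κ) (fun t _ => div_nonneg (ha0 t) hκ0.le) (fun s hs => ?_) hy
    · refine this.trans ?_
      have h1 : ∫ t in c..y, a t / κ ≤ 1 := by
        rw [intervalIntegral.integral_div, div_le_one hκ0]
        exact (intervalIntegral.integral_mono_interval le_rfl hy.1 hy.2
          (Eventually.of_forall fun t => ha0 t) ha).trans hA
      rw [mul_comm]
      gcongr
      exact (Real.exp_le_exp.2 h1).trans (by linarith [Real.exp_one_lt_d9])
    · have h1 := hUest s hs
      have h2 := hVest s hs
      have h3 : ∫ t in c..s, Real.exp (-2 * κ * (s - t)) * (a t * (m t / (2 * κ))) ≤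
          ∫ t in c..s, a t * (m t / (2 * κ)) := by
        refine intervalIntegral.integral_mono_on hs.1 (haem s hs) (ham s hs) fun t ht => ?_
        refine mul_le_of_le_one_left ?_ (hexp s t ht.2)
        exact mul_nonneg (ha0 t) (div_nonneg (hm0 t) (by positivity))
      have h4 : ∫ t in c..s, a t / κ * m t = 2 * ∫ t in c..s, a t * (m t / (2 * κ)) := by
        rw [← intervalIntegral.integral_const_mul]
        congr 1; ext t; field_simp
      have h5 : ‖U s‖ ≤ ‖U s - U c‖ + ‖U c‖ := by
        simpa using norm_add_le (U s - U c) (U c)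
      have h6 : Real.exp (-2 * κ * (s - c)) * ‖V c‖ ≤ ‖V c‖ :=
        mul_le_of_le_one_left (norm_nonneg _) (hexp s c hs.1)
      rw [h4]
      simp only [hm, hmc, ← hUc, ← hVc]
      linarith
  have hm3 : ∀ t ∈ Icc c d, m t / (2 * κ) ≤ 2 / κ * mc := fun t ht => by
    have := hgr t ht
    rw [div_le_iff₀ (by positivity)]
    calc m t ≤ 4 * mc := by linarith
      _ = 2 / κ * mc * (2 * κ) := by field_simp; ring
  constructor
  · rw [← hUc]
    refine (hUest x hx).trans ?_
    calc ∫ t in c..x, a t * (m t / (2 * κ)) ≤ ∫ t in c..x, a t * (2 / κ * mc) := by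
          refine intervalIntegral.integral_mono_on hx.1 (ham x hx)
            ((ha.mul_const _).mono_set (hsub x hx)) fun t ht => ?_
          exact mul_le_mul_of_nonneg_left (hm3 t ⟨ht.1, ht.2.trans hx.2⟩) (ha0 t)
      _ = (∫ t in c..x, a t) * (2 / κ * mc) := intervalIntegral.integral_mul_const _ _
      _ ≤ (∫ t in c..d, a t) * (2 / κ * mc) := by
          gcongr
          exact intervalIntegral.integral_mono_interval le_rfl hx.1 hx.2
            (Eventually.of_forall fun t => ha0 t) ha
      _ = _ := by ring
  · refine (hVest x hx).trans ?_
    rw [add_mul]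
    refine add_le_add ?_ ?_
    · gcongr
      rw [hVc, hmc]
      linarith [norm_nonneg (waveMinus p ρ z z' c)]
    · have hae : IntervalIntegrable (fun t => Real.exp (-2 * κ * (x - t)) * a t) volume c x :=
        (ha.mono_set (hsub x hx)).continuousOn_mul (by fun_prop)
      calc _ ≤ ∫ t in c..x, Real.exp (-2 * κ * (x - t)) * a t * (2 / κ * mc) := by
            refine intervalIntegral.integral_mono_on hx.1 (haem x hx)
              (hae.mul_const _) fun t ht => ?_
            rw [← mul_assoc]
            exact mul_le_mul_of_nonneg_left (hm3 t ⟨ht.1, ht.2.trans hx.2⟩)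
              (mul_nonneg (Real.exp_pos _).le (ha0 t))
        _ = _ := by rw [intervalIntegral.integral_mul_const]; ring

end WKB

theorem tendsto_integral_exp_mul_zero {a : ℝ → ℝ} {c x : ℝ} (hcx : c ≤ x)
    (ha : IntervalIntegrable a volume c x) :
    Tendsto (fun κ : ℝ => ∫ t in c..x, Real.exp (-2 * κ * (x - t)) * a t) atTop (𝓝 0) := by
  have h0 : (0 : ℝ) = ∫ t in c..x, (0 : ℝ) := by simp
  rw [h0]
  refine intervalIntegral.tendsto_integral_filter_of_dominated_convergence (fun t => ‖a t‖)
    (Eventually.of_forall fun κ => ?_) ?_ ha.norm ?_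
  · have h : IntervalIntegrable (fun t => Real.exp (-2 * κ * (x - t)) * a t) volume c x :=
      ha.continuousOn_mul (by fun_prop)
    rw [uIoc_of_le hcx]
    exact h.1.aestronglyMeasurable
  · filter_upwards [eventually_ge_atTop (0 : ℝ)] with κ hκ
    refine Eventually.of_forall fun t ht => ?_
    rw [uIoc_of_le hcx] at ht
    rw [norm_mul, Real.norm_eq_abs, abs_of_pos (Real.exp_pos _)]
    refine mul_le_of_le_one_left (norm_nonneg _) (Real.exp_le_one_iff.2 ?_)
    nlinarith [ht.2]
  · have h1 : ∀ᵐ t : ℝ, t ≠ x := by simp [ae_iff, measure_singleton]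
    filter_upwards [h1] with t ht htm
    rw [uIoc_of_le hcx] at htm
    have hlt : 0 < x - t := sub_pos.2 (lt_of_le_of_ne htm.2 ht)
    rw [← zero_mul (a t)]
    refine Tendsto.mul_const _ (Real.tendsto_exp_atBot.comp ?_)
    have : (fun κ : ℝ => -2 * κ * (x - t)) = fun κ => (-2 * (x - t)) * κ := by ext; ring
    rw [this]
    exact tendsto_id.const_mul_atTop_of_neg (by linarith)

theorem tendsto_mul_exp_neg_mul {δ : ℝ} (hδ : 0 < δ) :
    Tendsto (fun κ : ℝ => κ * Real.exp (-2 * κ * δ)) atTop (𝓝 0) := by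
  have h := (Real.tendsto_pow_mul_exp_neg_atTop_nhds_zero 1).comp
    (tendsto_id.const_mul_atTop (show (0 : ℝ) < 2 * δ by linarith))
  have h2 := h.const_mul (2 * δ)⁻¹
  rw [mul_zero] at h2
  refine h2.congr fun κ => ?_
  simp only [Function.comp, id, pow_one]
  rw [show -(2 * δ * κ) = -2 * κ * δ by ring]
  field_simp

theorem abs_phase_im_sub_le {p : ℝ → ℂ} {ρ : ℂ} {c d P x : ℝ}
    (hp : ContinuousOn p (Icc c d)) (hP : ∀ t ∈ Icc c d, ‖p t‖ ≤ P) (hx : x ∈ Icc c d) :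
    |(phase p ρ c x).im - ρ.im * (x - c)| ≤ P * (x - c) := by
  have hsub : Icc c x ⊆ Icc c d := Icc_subset_Icc le_rfl hx.2
  have hpi : IntervalIntegrable (fun t => p t / 2) volume c x :=
    ContinuousOn.intervalIntegrable (by
      rw [uIcc_of_le hx.1]; exact (hp.mono hsub).div_const _)
  have e : phase p ρ c x = ρ * ((x - c : ℝ) : ℂ) + ∫ t in c..x, p t / 2 := by
    simp only [phase, waveNumber]
    rw [intervalIntegral.integral_add intervalIntegrable_const hpi]
    simp [mul_comm]
  have e2 : (phase p ρ c x).im - ρ.im * (x - c) = (∫ t in c..x, p t / 2).im := by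
    rw [e, Complex.add_im, Complex.im_mul_ofReal]; ring
  rw [e2]
  refine (Complex.abs_im_le_norm _).trans ?_
  have h := intervalIntegral.norm_integral_le_of_norm_le_const (a := c) (b := x) (C := P)
    (f := fun t => p t / 2) fun t ht => by
      rw [uIoc_of_le hx.1] at ht
      have := hP t ⟨ht.1.le, ht.2.trans hx.2⟩
      rw [norm_div, RCLike.norm_ofNat]
      linarith [norm_nonneg (p t)]
  rwa [abs_of_nonneg (by linarith [hx.1])] at h

section Family

variable {ι : Type*} {l : Filter ι} {r : ι → ℂ} {K : ℝ}

/-- Asymptotics of the wave components across an interval. -/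
theorem wave_step (hr : Tendsto (fun i => (r i).im) l atTop) (hK0 : 0 ≤ K)
    (hK : ∀ᶠ i in l, ‖r i‖ ≤ K * (r i).im) {p p' q : ℝ → ℂ} {c d : ℝ} (hcd : c ≤ d)
    (hp : IsPrimitiveOn p p' c d) (hq : IntervalIntegrable q volume c d) {z z' : ι → ℝ → ℂ}
    (hz : ∀ i, IsPrimitiveOn (z i) (z' i) c d)
    (hz' : ∀ i, IsPrimitiveOn (z' i) (fun x => -(pencilPotential p q (r i) x * z i x)) c d)
    {L : ℝ} (hL0 : 0 ≤ L)
    (hL : ∀ᶠ i in l, waveMinus p (r i) (z i) (z' i) c ≠ 0 ∧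
      ‖wavePlus p (r i) (z i) (z' i) c‖ ≤ L * ‖waveMinus p (r i) (z i) (z' i) c‖)
    {x : ℝ} (hx : x ∈ Ioc c d) :
    (∃ C > 0, ∀ᶠ i in l,
      ‖waveMinus p (r i) (z i) (z' i) c‖ * Real.exp ((r i).im * (x - c)) ≤
        C * ‖waveMinus p (r i) (z i) (z' i) x‖ ∧
      ‖waveMinus p (r i) (z i) (z' i) x‖ ≤
        C * (‖waveMinus p (r i) (z i) (z' i) c‖ * Real.exp ((r i).im * (x - c)))) ∧
    Tendsto (fun i => r i * (wavePlus p (r i) (z i) (z' i) x / waveMinus p (r i) (z i) (z' i) x)) l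
      (𝓝 0) := by
  have hx' : x ∈ Icc c d := Ioc_subset_Icc_self hx
  have hpc := hp.continuousOn hcd
  obtain ⟨P, hP⟩ := isCompact_Icc.exists_bound_of_continuousOn hpc
  have hP0 : 0 ≤ P := (norm_nonneg _).trans (hP c ⟨le_rfl, hcd⟩)
  set a : ℝ → ℝ := fun t => ‖p t ^ 2 / 4 - q t‖ + ‖p' t‖ with ha_def
  have ha : IntervalIntegrable a volume c d := by
    have h1 : IntervalIntegrable (fun t => p t ^ 2 / 4) volume c d :=
      ContinuousOn.intervalIntegrable (by rw [uIcc_of_le hcd]; exact (hpc.pow 2).div_const _)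
    exact (h1.sub hq).norm.add hp.1.norm
  set A := ∫ t in c..d, a t with hA
  have hA0 : 0 ≤ A := intervalIntegral.integral_nonneg hcd fun t _ => by positivity
  have hax : IntervalIntegrable a volume c x := ha.mono_set (by
    rw [uIcc_of_le hcd, uIcc_of_le hx'.1]; exact Icc_subset_Icc le_rfl hx'.2)
  set κ : ι → ℝ := fun i => (r i).im - P with hκ_def
  have hκ : Tendsto κ l atTop := tendsto_atTop_add_const_right _ _ hr
  set J : ℝ → ℝ := fun κ => Real.exp (-2 * κ * (x - c)) +
    2 / κ * ∫ t in c..x, Real.exp (-2 * κ * (x - t)) * a t with hJ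
  -- the pointwise bounds
  have main : ∀ᶠ i in l, ‖waveMinus p (r i) (z i) (z' i) c‖ / 2 ≤
        ‖waveMinus p (r i) (z i) (z' i) x‖ * Real.exp (-(phase p (r i) c x).im) ∧
      ‖waveMinus p (r i) (z i) (z' i) x‖ * Real.exp (-(phase p (r i) c x).im) ≤
        2 * ‖waveMinus p (r i) (z i) (z' i) c‖ ∧
      ‖wavePlus p (r i) (z i) (z' i) x‖ * Real.exp (-(phase p (r i) c x).im) ≤
        J (κ i) * ((1 + L) * ‖waveMinus p (r i) (z i) (z' i) c‖) := by
    filter_upwards [hL, hκ.eventually_ge_atTop A, hκ.eventually_gt_atTop 0,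
      hκ.eventually_ge_atTop (4 * A * (1 + L))] with i h1 h2 h3 h4
    have hk : ∀ t ∈ Icc c d, κ i ≤ (waveNumber p (r i) t).im := fun t ht => by
      have e : (waveNumber p (r i) t).im = (r i).im + (p t).im / 2 := by simp [waveNumber]
      have h5 := (abs_le.1 ((Complex.abs_im_le_norm (p t)).trans (hP t ht))).1
      rw [e]; simp only [hκ_def]; linarith
    obtain ⟨e1, e2⟩ := wave_estimate hcd hp (hz i) (hz' i) ha (fun _ => le_rfl) h3 hk h2 hx'
    rw [norm_mul, norm_exp_I_mul_phase] at e2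
    set u := waveMinus p (r i) (z i) (z' i) x with hu
    set uc := waveMinus p (r i) (z i) (z' i) c with huc
    have hsum : ‖uc‖ + ‖wavePlus p (r i) (z i) (z' i) c‖ ≤ (1 + L) * ‖uc‖ := by linarith [h1.2]
    have e3 : 2 / κ i * A * (‖uc‖ + ‖wavePlus p (r i) (z i) (z' i) c‖) ≤ ‖uc‖ / 2 := by
      calc _ ≤ 2 / κ i * A * ((1 + L) * ‖uc‖) := by gcongr
        _ = (4 * A * (1 + L)) / κ i * (‖uc‖ / 2) := by field_simp; ring
        _ ≤ 1 * (‖uc‖ / 2) := by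
          gcongr
          rwa [div_le_one h3]
        _ = _ := one_mul _
    have e4 := e1.trans e3
    have n1 := norm_sub_norm_le (u * Complex.exp (Complex.I * phase p (r i) c x)) uc
    have n2 := norm_sub_norm_le uc (u * Complex.exp (Complex.I * phase p (r i) c x))
    rw [norm_sub_rev] at n2
    rw [norm_mul, norm_exp_I_mul_phase] at n1 n2
    have hJ0 : 0 ≤ J (κ i) := by
      have : 0 ≤ ∫ t in c..x, Real.exp (-2 * κ i * (x - t)) * a t :=
        intervalIntegral.integral_nonneg hx'.1 fun t _ => by positivity
      simp only [hJ]; positivity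
    refine ⟨by linarith, by linarith [norm_nonneg uc], e2.trans ?_⟩
    exact mul_le_mul_of_nonneg_left hsum hJ0
  have hph := fun i => abs_le.1 (abs_phase_im_sub_le (ρ := r i) hpc hP hx')
  refine ⟨⟨2 * Real.exp (P * (x - c)), by positivity, ?_⟩, ?_⟩
  · filter_upwards [main] with i hi
    obtain ⟨h1, h2, -⟩ := hi
    have h3 := hph i
    rw [Real.exp_neg, ← div_eq_mul_inv] at h1 h2
    rw [div_le_div_iff₀ (by norm_num) (Real.exp_pos _)] at h1
    rw [div_le_iff₀ (Real.exp_pos _)] at h2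
    have e1 : Real.exp ((r i).im * (x - c)) ≤
        Real.exp (P * (x - c)) * Real.exp (phase p (r i) c x).im := by
      rw [← Real.exp_add]; exact Real.exp_le_exp.2 (by linarith)
    have e2 : Real.exp (phase p (r i) c x).im ≤
        Real.exp (P * (x - c)) * Real.exp ((r i).im * (x - c)) := by
      rw [← Real.exp_add]; exact Real.exp_le_exp.2 (by linarith)
    constructor
    · calc _ ≤ ‖waveMinus p (r i) (z i) (z' i) c‖ *
          (Real.exp (P * (x - c)) * Real.exp (phase p (r i) c x).im) := by gcongr
        _ = Real.exp (P * (x - c)) * (‖waveMinus p (r i) (z i) (z' i) c‖ *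
          Real.exp (phase p (r i) c x).im) := by ring
        _ ≤ Real.exp (P * (x - c)) * (‖waveMinus p (r i) (z i) (z' i) x‖ * 2) := by gcongr
        _ = _ := by ring
    · calc _ ≤ _ := h2
        _ ≤ 2 * ‖waveMinus p (r i) (z i) (z' i) c‖ *
          (Real.exp (P * (x - c)) * Real.exp ((r i).im * (x - c))) := by gcongr
        _ = _ := by ring
  · have hlim : Tendsto (fun κ : ℝ => 4 * K * (1 + L) * (κ * Real.exp (-2 * κ * (x - c)) +
        2 * ∫ t in c..x, Real.exp (-2 * κ * (x - t)) * a t)) atTop (𝓝 0) := by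
      have := ((tendsto_mul_exp_neg_mul (sub_pos.2 hx.1)).add
        ((tendsto_integral_exp_mul_zero hx'.1 hax).const_mul 2)).const_mul (4 * K * (1 + L))
      simpa using this
    refine squeeze_zero_norm' ?_ (hlim.comp hκ)
    filter_upwards [main, hL, hK, hκ.eventually_ge_atTop P, hκ.eventually_gt_atTop 0]
      with i h1 h2 h3 h4 h5
    obtain ⟨m1, -, m3⟩ := h1
    set u := waveMinus p (r i) (z i) (z' i) x
    set uc := waveMinus p (r i) (z i) (z' i) c
    set e := Real.exp (-(phase p (r i) c x).im) with he
    have he0 : 0 < e := Real.exp_pos _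
    have huc : 0 < ‖uc‖ := norm_pos_iff.2 h2.1
    have hu : 0 < ‖u‖ * e := by linarith
    have hr2 : ‖r i‖ ≤ K * (2 * κ i) := h3.trans (by
      gcongr; simp only [hκ_def] at h4 ⊢; linarith)
    have hJ0 : 0 ≤ J (κ i) := by
      have : 0 ≤ ∫ t in c..x, Real.exp (-2 * κ i * (x - t)) * a t :=
        intervalIntegral.integral_nonneg hx'.1 fun t _ => by positivity
      simp only [hJ]; positivity
    rw [norm_mul, norm_div]
    have q1 : ‖wavePlus p (r i) (z i) (z' i) x‖ / ‖u‖ ≤ 2 * (1 + L) * J (κ i) := by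
      rw [← mul_div_mul_right _ _ he0.ne', div_le_iff₀ hu]
      calc _ ≤ _ := m3
        _ = 2 * (1 + L) * J (κ i) * (‖uc‖ / 2) := by ring
        _ ≤ _ := by gcongr
    calc _ ≤ K * (2 * κ i) * (2 * (1 + L) * J (κ i)) := by gcongr
      _ = _ := by simp only [hJ, Function.comp]; field_simp; ring

/-- Asymptotics of the wave components across a node. -/
theorem wave_jump (hr : Tendsto (fun i => ‖r i‖) l atTop) {γ η' η P : ℂ}
    {z z' : ι → ℂ}
    (hu : ∀ᶠ i in l, z' i - Complex.I * (r i + P) * z i ≠ 0)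
    (hw : Tendsto (fun i => r i * ((z' i + Complex.I * (r i + P) * z i) /
      (z' i - Complex.I * (r i + P) * z i))) l (𝓝 0)) :
    Tendsto (fun i => ((γ⁻¹ * z' i + (Complex.I * r i * η' + η) * z i) -
      Complex.I * (r i + P) * (γ * z i)) / (z' i - Complex.I * (r i + P) * z i)) l
      (𝓝 ((γ + γ⁻¹) / 2 - η' / 2)) ∧
    Tendsto (fun i => ((γ⁻¹ * z' i + (Complex.I * r i * η' + η) * z i) +
      Complex.I * (r i + P) * (γ * z i)) / (z' i - Complex.I * (r i + P) * z i)) l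
      (𝓝 (γ⁻¹ / 2 - (η' + γ) / 2)) := by
  set w : ι → ℂ := fun i => (z' i + Complex.I * (r i + P) * z i) /
      (z' i - Complex.I * (r i + P) * z i) with hwdef
  have hinv : Tendsto (fun i => (r i)⁻¹) l (𝓝 0) := by
    rw [tendsto_zero_iff_norm_tendsto_zero]
    simpa only [norm_inv, Function.comp_def] using tendsto_inv_atTop_zero.comp hr
  have hr0 : ∀ᶠ i in l, r i ≠ 0 := by
    filter_upwards [hr.eventually_gt_atTop 0] with i hi using norm_pos_iff.1 hi
  have hk0 : ∀ᶠ i in l, r i + P ≠ 0 := by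
    filter_upwards [hr.eventually_gt_atTop ‖P‖] with i hi h
    rw [eq_neg_of_add_eq_zero_left h, norm_neg] at hi
    exact lt_irrefl _ hi
  have hw0 : Tendsto w l (𝓝 0) := by
    have := hw.mul hinv
    rw [zero_mul] at this
    refine this.congr' ?_
    filter_upwards [hr0] with i hi
    rw [hwdef]
    field_simp
  set s : ι → ℂ := fun i => (Complex.I * η' + η * (r i)⁻¹) / (Complex.I * (1 + P * (r i)⁻¹))
    with hs
  have hs0 : Tendsto s l (𝓝 η') := by
    have h1 : Tendsto (fun i => Complex.I * η' + η * (r i)⁻¹) l (𝓝 (Complex.I * η' + η * 0)) :=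
      tendsto_const_nhds.add (hinv.const_mul _)
    have h2 : Tendsto (fun i => Complex.I * (1 + P * (r i)⁻¹)) l (𝓝 (Complex.I * (1 + P * 0))) :=
      (tendsto_const_nhds.add (hinv.const_mul _)).const_mul _
    have := h1.div h2 (by simp)
    simp only [mul_zero, add_zero, mul_one, mul_div_cancel_left₀ _ Complex.I_ne_zero] at this
    exact this
  have hseq : ∀ i, r i ≠ 0 → r i + P ≠ 0 →
      (Complex.I * r i * η' + η) = s i * (Complex.I * (r i + P)) := fun i h1 h2 => by
    have h3 : (1 + P * (r i)⁻¹) ≠ 0 := by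
      intro h; apply h2; field_simp at h; simpa using h
    have e : Complex.I * (r i + P) = Complex.I * (1 + P * (r i)⁻¹) * r i := by field_simp
    rw [hs, e]
    have h4 : Complex.I * (1 + P * (r i)⁻¹) ≠ 0 := mul_ne_zero Complex.I_ne_zero h3
    rw [← mul_assoc, div_mul_cancel₀ _ h4]
    field_simp
  have base := fun (σ : ℂ) => ((hw0.const_add 1).const_mul (γ⁻¹ / 2)).add
    (((hs0.add_const σ).mul (hw0.sub_const 1)).div_const 2)
  constructor
  · have := base (-γ)
    rw [show γ⁻¹ / 2 * (1 + 0) + (η' + -γ) * (0 - 1) / 2 = (γ + γ⁻¹) / 2 - η' / 2 by ring] at this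
    refine this.congr' ?_
    filter_upwards [hu, hr0, hk0] with i h1 h2 h3
    rw [hseq i h2 h3, hwdef]
    field_simp
    ring
  · have := base γ
    rw [show γ⁻¹ / 2 * (1 + 0) + (η' + γ) * (0 - 1) / 2 = γ⁻¹ / 2 - (η' + γ) / 2 by ring] at this
    refine this.congr' ?_
    filter_upwards [hu, hr0, hk0] with i h1 h2 h3
    rw [hseq i h2 h3, hwdef]
    field_simp
    ring

end Family

namespace PieceSol

variable {ι : Type*} {l : Filter ι} {r : ι → ℂ} {K : ℝ} {N : ℕ} {b : ℕ → ℝ} {p p' q : ℝ → ℂ}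
  {γ η' η : ℕ → ℂ} {z z' : ι → ℕ → ℝ → ℂ}

/-- Asymptotics of the wave components of a solution with jumps. -/
theorem wave_asymptotics (hr : Tendsto (fun i => (r i).im) l atTop) (hK0 : 0 ≤ K)
    (hK : ∀ᶠ i in l, ‖r i‖ ≤ K * (r i).im) (hb : ∀ j < N, b j < b (j + 1))
    (hp : IsPrimitiveOn p p' (b 0) (b N)) (hq : IntervalIntegrable q volume (b 0) (b N))
    (hξ : ∀ j, j + 1 < N → (γ (j + 1) + (γ (j + 1))⁻¹) / 2 - η' (j + 1) / 2 ≠ 0)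
    (hz : ∀ i, PieceSol N b (pencilPotential p q (r i)) γ (jumpCoeff η' η (r i)) (z i) (z' i))
    {L₀ : ℝ} (hL0 : 0 ≤ L₀)
    (hL : ∀ᶠ i in l, waveMinus p (r i) (z i 0) (z' i 0) (b 0) ≠ 0 ∧
      ‖wavePlus p (r i) (z i 0) (z' i 0) (b 0)‖ ≤
        L₀ * ‖waveMinus p (r i) (z i 0) (z' i 0) (b 0)‖)
    {j : ℕ} (hj : j < N) : ∀ x ∈ Ioc (b j) (b (j + 1)),
    (∃ C > 0, ∀ᶠ i in l,
      ‖waveMinus p (r i) (z i 0) (z' i 0) (b 0)‖ * Real.exp ((r i).im * (x - b 0)) ≤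
        C * ‖waveMinus p (r i) (z i j) (z' i j) x‖ ∧
      ‖waveMinus p (r i) (z i j) (z' i j) x‖ ≤
        C * (‖waveMinus p (r i) (z i 0) (z' i 0) (b 0)‖ * Real.exp ((r i).im * (x - b 0)))) ∧
    Tendsto (fun i => r i * (wavePlus p (r i) (z i j) (z' i j) x /
      waveMinus p (r i) (z i j) (z' i j) x)) l (𝓝 0) := by
  have hrn : Tendsto (fun i => ‖r i‖) l atTop :=
    tendsto_atTop_mono (fun i => Complex.im_le_norm _) hr
  induction j with
  | zero =>
    intro x hx
    exact wave_step hr hK0 hK (hb 0 hj).le (hp.node hb hj) (hq.node hb hj)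
      (fun i => (hz i).prim 0 hj) (fun i => (hz i).prim' 0 hj) hL0 hL hx
  | succ k ih =>
    have hk : k < N := by omega
    obtain ⟨⟨C, hC, hCi⟩, hw⟩ := ih hk (b (k + 1)) ⟨hb k hk, le_rfl⟩
    have hne : ∀ᶠ i in l, waveMinus p (r i) (z i k) (z' i k) (b (k + 1)) ≠ 0 := by
      filter_upwards [hCi, hL] with i h1 h2 h3
      have h4 := h1.1
      rw [h3, norm_zero, mul_zero] at h4
      have : 0 < ‖waveMinus p (r i) (z i 0) (z' i 0) (b 0)‖ *
        Real.exp ((r i).im * (b (k + 1) - b 0)) := mul_pos (norm_pos_iff.2 h2.1) (Real.exp_pos _)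
      linarith
    obtain ⟨j1, j2⟩ := wave_jump (γ := γ (k + 1)) (η' := η' (k + 1)) (η := η (k + 1))
      (P := p (b (k + 1)) / 2) hrn hne hw
    set ξ := (γ (k + 1) + (γ (k + 1))⁻¹) / 2 - η' (k + 1) / 2 with hξdef
    set ξ' := (γ (k + 1))⁻¹ / 2 - (η' (k + 1) + γ (k + 1)) / 2
    have hξ0 : 0 < ‖ξ‖ := norm_pos_iff.2 (hξ k hj)
    have j1' : Tendsto (fun i => ‖waveMinus p (r i) (z i (k + 1)) (z' i (k + 1)) (b (k + 1)) /
        waveMinus p (r i) (z i k) (z' i k) (b (k + 1))‖) l (𝓝 ‖ξ‖) := by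
      refine j1.norm.congr fun i => ?_
      simp only [waveMinus, waveNumber, (hz i).jump k hj, (hz i).jump' k hj, jumpCoeff]
    have j2' : Tendsto (fun i => ‖wavePlus p (r i) (z i (k + 1)) (z' i (k + 1)) (b (k + 1)) /
        waveMinus p (r i) (z i k) (z' i k) (b (k + 1))‖) l (𝓝 ‖ξ'‖) := by
      refine j2.norm.congr fun i => ?_
      simp only [waveMinus, wavePlus, waveNumber, (hz i).jump k hj, (hz i).jump' k hj, jumpCoeff]
    have hcomp : ∀ᶠ i in l,
        ‖ξ‖ / 2 * ‖waveMinus p (r i) (z i k) (z' i k) (b (k + 1))‖ ≤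
          ‖waveMinus p (r i) (z i (k + 1)) (z' i (k + 1)) (b (k + 1))‖ ∧
        ‖waveMinus p (r i) (z i (k + 1)) (z' i (k + 1)) (b (k + 1))‖ ≤
          2 * ‖ξ‖ * ‖waveMinus p (r i) (z i k) (z' i k) (b (k + 1))‖ ∧
        ‖wavePlus p (r i) (z i (k + 1)) (z' i (k + 1)) (b (k + 1))‖ ≤
          (‖ξ'‖ + 1) * ‖waveMinus p (r i) (z i k) (z' i k) (b (k + 1))‖ := by
      filter_upwards [hne, j1'.eventually (lt_mem_nhds (half_lt_self hξ0)),
        j1'.eventually (gt_mem_nhds (show ‖ξ‖ < 2 * ‖ξ‖ by linarith)),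
        j2'.eventually (gt_mem_nhds (lt_add_one ‖ξ'‖))] with i h0 h1 h2 h3
      have h0' := norm_pos_iff.2 h0
      rw [norm_div] at h1 h2 h3
      rw [lt_div_iff₀ h0'] at h1
      rw [div_lt_iff₀ h0'] at h2 h3
      exact ⟨h1.le, h2.le, h3.le⟩
    have hnext : ∀ᶠ i in l,
        waveMinus p (r i) (z i (k + 1)) (z' i (k + 1)) (b (k + 1)) ≠ 0 ∧
        ‖wavePlus p (r i) (z i (k + 1)) (z' i (k + 1)) (b (k + 1))‖ ≤ ((‖ξ'‖ + 1) * (2 / ‖ξ‖)) *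
          ‖waveMinus p (r i) (z i (k + 1)) (z' i (k + 1)) (b (k + 1))‖ := by
      filter_upwards [hne, hcomp] with i h0 h1
      have h0' := norm_pos_iff.2 h0
      refine ⟨norm_pos_iff.1 (lt_of_lt_of_le (by positivity) h1.1), h1.2.2.trans ?_⟩
      rw [mul_assoc]
      gcongr
      have := mul_le_mul_of_nonneg_left h1.1 (show 0 ≤ 2 / ‖ξ‖ by positivity)
      refine le_trans (le_of_eq ?_) this
      field_simp
    intro x hx
    obtain ⟨⟨D, hD, hDi⟩, hw'⟩ := wave_step hr hK0 hK (hb (k + 1) hj).le (hp.node hb hj)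
      (hq.node hb hj) (fun i => (hz i).prim (k + 1) hj) (fun i => (hz i).prim' (k + 1) hj)
      (by positivity) hnext hx
    refine ⟨⟨C * (2 / ‖ξ‖) * D + D * (2 * ‖ξ‖) * C, by positivity, ?_⟩, hw'⟩
    filter_upwards [hCi, hcomp, hDi] with i h1 h2 h3
    have hexp : Real.exp ((r i).im * (x - b 0)) = Real.exp ((r i).im * (b (k + 1) - b 0)) *
        Real.exp ((r i).im * (x - b (k + 1))) := by
      rw [← Real.exp_add]; congr 1; ring
    rw [hexp]
    have e1 := (Real.exp_pos ((r i).im * (b (k + 1) - b 0)))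
    have e2 := (Real.exp_pos ((r i).im * (x - b (k + 1))))
    generalize Real.exp ((r i).im * (b (k + 1) - b 0)) = E1 at *
    generalize Real.exp ((r i).im * (x - b (k + 1))) = E2 at *
    have n0 := norm_nonneg (waveMinus p (r i) (z i 0) (z' i 0) (b 0))
    have n1 := norm_nonneg (waveMinus p (r i) (z i (k + 1)) (z' i (k + 1)) x)
    generalize ‖waveMinus p (r i) (z i 0) (z' i 0) (b 0)‖ = u0 at *
    generalize ‖waveMinus p (r i) (z i (k + 1)) (z' i (k + 1)) x‖ = ux at *
    generalize ‖waveMinus p (r i) (z i (k + 1)) (z' i (k + 1)) (b (k + 1))‖ = uR at *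
    generalize ‖waveMinus p (r i) (z i k) (z' i k) (b (k + 1))‖ = uL at *
    have h2' : uL ≤ 2 / ‖ξ‖ * uR := by
      have := mul_le_mul_of_nonneg_left h2.1 (show 0 ≤ 2 / ‖ξ‖ by positivity)
      refine le_trans (le_of_eq ?_) this
      field_simp
    constructor
    · calc u0 * (E1 * E2) = (u0 * E1) * E2 := by ring
        _ ≤ (C * uL) * E2 := mul_le_mul_of_nonneg_right h1.1 e2.le
        _ ≤ (C * (2 / ‖ξ‖ * uR)) * E2 := by gcongr
        _ = C * (2 / ‖ξ‖) * (uR * E2) := by ring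
        _ ≤ C * (2 / ‖ξ‖) * (D * ux) := mul_le_mul_of_nonneg_left h3.1 (by positivity)
        _ = (C * (2 / ‖ξ‖) * D) * ux := by ring
        _ ≤ _ := by gcongr; exact le_add_of_nonneg_right (by positivity)
    · calc ux ≤ D * (uR * E2) := h3.2
        _ ≤ D * ((2 * ‖ξ‖ * uL) * E2) := by gcongr; exact h2.2.1
        _ ≤ D * ((2 * ‖ξ‖ * (C * (u0 * E1))) * E2) := by gcongr; exact h1.2
        _ = (D * (2 * ‖ξ‖) * C) * (u0 * (E1 * E2)) := by ring
        _ ≤ _ := by gcongr; exact le_add_of_nonneg_left (by positivity)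

/-- Asymptotics of the solution with jumps that vanishes at the left end. -/
theorem dirichlet_asymptotics (hr : Tendsto (fun i => (r i).im) l atTop) (hK0 : 0 ≤ K)
    (hK : ∀ᶠ i in l, ‖r i‖ ≤ K * (r i).im) (hb : ∀ j < N, b j < b (j + 1))
    (hp : IsPrimitiveOn p p' (b 0) (b N)) (hq : IntervalIntegrable q volume (b 0) (b N))
    (hξ : ∀ j, j + 1 < N → (γ (j + 1) + (γ (j + 1))⁻¹) / 2 - η' (j + 1) / 2 ≠ 0)
    (hz : ∀ i, PieceSol N b (pencilPotential p q (r i)) γ (jumpCoeff η' η (r i)) (z i) (z' i))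
    (h0 : ∀ i, z i 0 (b 0) = 0) (h0' : ∀ i, ‖z' i 0 (b 0)‖ = 1)
    {j : ℕ} (hj : j < N) {x : ℝ} (hx : x ∈ Ioc (b j) (b (j + 1))) :
    (∃ C > 0, ∀ᶠ i in l,
      Real.exp ((r i).im * (x - b 0)) ≤ C * (‖r i‖ * ‖z i j x‖) ∧
      ‖r i‖ * ‖z i j x‖ ≤ C * Real.exp ((r i).im * (x - b 0))) ∧
    Tendsto (fun i => z' i j x / z i j x + Complex.I * (r i + p x / 2)) l (𝓝 0) := by
  have hrn : Tendsto (fun i => ‖r i‖) l atTop :=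
    tendsto_atTop_mono (fun i => Complex.im_le_norm _) hr
  have hu0 : ∀ i, ‖waveMinus p (r i) (z i 0) (z' i 0) (b 0)‖ = 1 := fun i => by
    simp [waveMinus, h0 i, h0' i]
  have hv0 : ∀ i, ‖wavePlus p (r i) (z i 0) (z' i 0) (b 0)‖ = 1 := fun i => by
    simp [wavePlus, h0 i, h0' i]
  obtain ⟨⟨C, hC, hCi⟩, hw⟩ := wave_asymptotics hr hK0 hK hb hp hq hξ hz (L₀ := 1) zero_le_one
    (Eventually.of_forall fun i => ⟨norm_pos_iff.1 (by rw [hu0]; exact one_pos), by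
      rw [hu0, hv0, mul_one]⟩) hj x hx
  simp only [hu0, one_mul] at hCi
  set u : ι → ℂ := fun i => waveMinus p (r i) (z i j) (z' i j) x with hu
  set v : ι → ℂ := fun i => wavePlus p (r i) (z i j) (z' i j) x with hv
  set k : ι → ℂ := fun i => waveNumber p (r i) x with hk
  have hune : ∀ᶠ i in l, u i ≠ 0 := by
    filter_upwards [hCi] with i h1 h2
    have h4 := h1.1
    simp only [hu] at h2
    rw [h2, norm_zero, mul_zero] at h4
    linarith [Real.exp_pos ((r i).im * (x - b 0))]
  have hinv : Tendsto (fun i => (r i)⁻¹) l (𝓝 0) := by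
    rw [tendsto_zero_iff_norm_tendsto_zero]
    simpa only [norm_inv, Function.comp_def] using tendsto_inv_atTop_zero.comp hrn
  have hrne : ∀ᶠ i in l, r i ≠ 0 := by
    filter_upwards [hrn.eventually_gt_atTop 0] with i hi using norm_pos_iff.1 hi
  have hw0 : Tendsto (fun i => v i / u i) l (𝓝 0) := by
    have := hw.mul hinv
    rw [zero_mul] at this
    refine this.congr' ?_
    filter_upwards [hrne] with i hi
    simp only [hu, hv]
    field_simp
  have hkw : Tendsto (fun i => k i * (v i / u i)) l (𝓝 0) := by
    have := hw.add (hw0.const_mul (p x / 2))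
    rw [mul_zero, add_zero] at this
    refine this.congr fun i => ?_
    simp only [hk, waveNumber]; ring
  have hkr : ∀ᶠ i in l, ‖r i‖ / 2 ≤ ‖k i‖ ∧ ‖k i‖ ≤ 2 * ‖r i‖ := by
    filter_upwards [hrn.eventually_ge_atTop (2 * ‖p x / 2‖)] with i hi
    have n1 := norm_add_le (r i) (p x / 2)
    have n2 := norm_sub_le (r i + p x / 2) (p x / 2)
    rw [add_sub_cancel_right] at n2
    simp only [hk, waveNumber]
    constructor <;> linarith [norm_nonneg (r i)]
  have hzu : ∀ i, 2 * Complex.I * k i * z i j x = v i - u i := fun i => by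
    simp only [hk, hv, hu, wavePlus, waveMinus]; ring
  have hwhalf : ∀ᶠ i in l, ‖v i‖ ≤ ‖u i‖ / 2 := by
    have := hw0.norm
    rw [norm_zero] at this
    filter_upwards [hune, this.eventually (gt_mem_nhds (show (0 : ℝ) < 1 / 2 by norm_num))]
      with i h1 h2
    rw [norm_div, div_lt_iff₀ (norm_pos_iff.2 h1)] at h2
    linarith
  have hzn : ∀ᶠ i in l, ‖u i‖ ≤ 8 * (‖r i‖ * ‖z i j x‖) ∧ ‖r i‖ * ‖z i j x‖ ≤ 8 * ‖u i‖ := by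
    filter_upwards [hkr, hwhalf] with i h1 h2
    have e := congrArg norm (hzu i)
    simp only [norm_mul, Complex.norm_I, RCLike.norm_ofNat, mul_one] at e
    have n1 := norm_sub_le (v i) (u i)
    have n2 := norm_sub_norm_le (u i) (v i)
    rw [norm_sub_rev] at n2
    have m1 := mul_le_mul_of_nonneg_right h1.1 (norm_nonneg (z i j x))
    have m2 := mul_le_mul_of_nonneg_right h1.2 (norm_nonneg (z i j x))
    constructor <;> nlinarith [norm_nonneg (u i)]
  refine ⟨⟨8 * C, by positivity, ?_⟩, ?_⟩
  · filter_upwards [hzn, hCi] with i h1 h2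
    constructor
    · calc _ ≤ _ := h2.1
        _ ≤ C * (8 * (‖r i‖ * ‖z i j x‖)) := by gcongr; exact h1.1
        _ = _ := by ring
    · calc _ ≤ _ := h1.2
        _ ≤ 8 * (C * Real.exp ((r i).im * (x - b 0))) := by gcongr; exact h2.2
        _ = _ := by ring
  · have hlim : Tendsto (fun i => 2 * Complex.I * (k i * (v i / u i)) / (v i / u i - 1)) l
        (𝓝 (2 * Complex.I * 0 / (0 - 1))) :=
      (hkw.const_mul _).div (hw0.sub_const 1) (by norm_num)
    rw [mul_zero, zero_div] at hlim
    refine hlim.congr' ?_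
    filter_upwards [hune, hzn, hrne, hkr] with i h1 h2 h3 h4
    have hr0 := norm_pos_iff.2 h3
    have hz0 : z i j x ≠ 0 := by
      intro h
      have := h2.1
      rw [h, norm_zero, mul_zero, mul_zero] at this
      exact h1 (norm_le_zero_iff.1 this)
    have hk0 : k i ≠ 0 := norm_pos_iff.1 (by linarith [h4.1])
    have hvu : v i - u i ≠ 0 := by
      rw [← hzu]
      exact mul_ne_zero (mul_ne_zero (mul_ne_zero two_ne_zero Complex.I_ne_zero) hk0) hz0
    have e1 : z' i j x / z i j x + Complex.I * (r i + p x / 2) = v i / z i j x := by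
      simp only [hv, wavePlus, waveNumber]; field_simp
    have e2 : v i / u i - 1 = (v i - u i) / u i := by field_simp
    rw [e1, e2, ← hzu]
    field_simp

end PieceSol

namespace PieceSol

variable {N : ℕ} {b : ℕ → ℝ} {p p' q Q : ℝ → ℂ} {γ η' η σ : ℕ → ℂ}

/-- The reflection `x ↦ T - x` of a solution with jumps. -/
theorem reflect {z z' : ℕ → ℝ → ℂ} (hz : PieceSol N b Q γ σ z z') (T : ℝ)
    (hγ : ∀ j, 1 ≤ j → j + 1 ≤ N → γ j ≠ 0) :
    PieceSol N (fun j => T - b (N - j)) (fun x => Q (T - x)) (fun j => (γ (N - j))⁻¹)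
      (fun j => σ (N - j)) (fun j x => z (N - 1 - j) (T - x))
      (fun j x => -z' (N - 1 - j) (T - x)) where
  prim j hj := by
    have h := (hz.prim (N - 1 - j) (by omega)).reflect T
    rw [show N - 1 - j + 1 = N - j by omega, show N - 1 - j = N - (j + 1) by omega] at h
    simpa only [show N - 1 - j = N - (j + 1) by omega] using h
  prim' j hj := by
    have h := ((hz.prim' (N - 1 - j) (by omega)).reflect T).neg
    rw [show N - 1 - j + 1 = N - j by omega, show N - 1 - j = N - (j + 1) by omega] at h
    simpa only [neg_neg, show N - 1 - j = N - (j + 1) by omega] using h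
  jump j hj := by
    have h := hz.jump (N - 1 - (j + 1)) (by omega)
    have hg := hγ (N - (j + 1)) (by omega) (by omega)
    rw [show N - 1 - (j + 1) + 1 = N - (j + 1) by omega] at h
    simp only [sub_sub_cancel, show N - 1 - j = N - (j + 1) by omega]
    rw [h]
    field_simp
  jump' j hj := by
    have h := hz.jump (N - 1 - (j + 1)) (by omega)
    have h' := hz.jump' (N - 1 - (j + 1)) (by omega)
    have hg := hγ (N - (j + 1)) (by omega) (by omega)
    rw [show N - 1 - (j + 1) + 1 = N - (j + 1) by omega] at h h'
    simp only [sub_sub_cancel, show N - 1 - j = N - (j + 1) by omega]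
    rw [h, h']
    field_simp
    ring

/-- Asymptotics along a non-real ray of the solutions with jumps vanishing at the left end. -/
theorem dirichlet_ray {z z' : ℂ → ℕ → ℝ → ℂ} {ω : ℂ} (hω : ω.im ≠ 0)
    (hb : ∀ j < N, b j < b (j + 1))
    (hp : IsPrimitiveOn p p' (b 0) (b N)) (hq : IntervalIntegrable q volume (b 0) (b N))
    (hξ : ∀ j, 1 ≤ j → j + 1 ≤ N →
      (γ j + (γ j)⁻¹) / 2 - η' j / 2 ≠ 0 ∧ (γ j + (γ j)⁻¹) / 2 + η' j / 2 ≠ 0)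
    (hz : ∀ ρ, PieceSol N b (pencilPotential p q ρ) γ (jumpCoeff η' η ρ) (z ρ) (z' ρ))
    (h0 : ∀ ρ, z ρ 0 (b 0) = 0) (h0' : ∀ ρ, ‖z' ρ 0 (b 0)‖ = 1)
    {j : ℕ} (hj : j < N) {x : ℝ} (hx : x ∈ Ioc (b j) (b (j + 1))) :
    (∃ C > 0, ∀ᶠ t : ℝ in atTop,
      Real.exp (t * |ω.im| * (x - b 0)) ≤ C * (t * ‖z (t * ω) j x‖) ∧
      t * ‖z (t * ω) j x‖ ≤ C * Real.exp (t * |ω.im| * (x - b 0))) ∧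
    Tendsto (fun t : ℝ => z' (t * ω) j x / z (t * ω) j x +
      Real.sign ω.im * (Complex.I * (t * ω + p x / 2))) atTop (𝓝 0) := by
  have hω0 : 0 < ‖ω‖ := norm_pos_iff.2 fun h => hω (by simp [h])
  have key : ∀ C > 0, (∀ᶠ t : ℝ in atTop,
      Real.exp (t * |ω.im| * (x - b 0)) ≤ C * (‖(t : ℂ) * ω‖ * ‖z (t * ω) j x‖) ∧
      ‖(t : ℂ) * ω‖ * ‖z (t * ω) j x‖ ≤ C * Real.exp (t * |ω.im| * (x - b 0))) →
      (∃ C > 0, ∀ᶠ t : ℝ in atTop,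
      Real.exp (t * |ω.im| * (x - b 0)) ≤ C * (t * ‖z (t * ω) j x‖) ∧
      t * ‖z (t * ω) j x‖ ≤ C * Real.exp (t * |ω.im| * (x - b 0))) := by
    intro C hC h
    refine ⟨C * ‖ω‖ + C / ‖ω‖, by positivity, ?_⟩
    filter_upwards [h, eventually_ge_atTop 0] with t ht ht0
    rw [norm_mul, Complex.norm_real, Real.norm_of_nonneg ht0] at ht
    constructor
    · calc _ ≤ _ := ht.1
        _ = C * ‖ω‖ * (t * ‖z (t * ω) j x‖) := by ring
        _ ≤ _ := by gcongr; exact le_add_of_nonneg_right (by positivity)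
    · have : t * ‖z (t * ω) j x‖ ≤ C / ‖ω‖ * Real.exp (t * |ω.im| * (x - b 0)) := by
        rw [div_mul_eq_mul_div, le_div_iff₀ hω0]
        calc _ = _ := by ring
          _ ≤ _ := ht.2
      refine this.trans ?_
      gcongr
      exact le_add_of_nonneg_left (by positivity)
  have hn : ∀ᶠ t : ℝ in atTop, ‖(t : ℂ) * ω‖ = ‖ω‖ / |ω.im| * (t * |ω.im|) := by
    filter_upwards [eventually_ge_atTop 0] with t ht
    rw [norm_mul, Complex.norm_real, Real.norm_of_nonneg ht]
    field_simp
  have hlim : Tendsto (fun t : ℝ => t * |ω.im|) atTop atTop :=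
    tendsto_id.atTop_mul_const (abs_pos.2 hω)
  rcases lt_or_gt_of_ne hω with h | h
  · have e : ∀ t : ℝ, (-((t : ℂ) * ω)).im = t * |ω.im| := fun t => by
      simp [abs_of_neg h]
    have H := dirichlet_asymptotics (l := atTop) (r := fun t : ℝ => -((t : ℂ) * ω))
      (p := fun x => -p x) (η' := fun j => -η' j) (η := η) (γ := γ) (q := q) (N := N) (b := b)
      (z := fun t => z (t * ω)) (z' := fun t => z' (t * ω))
      (by simpa only [e] using hlim) (K := ‖ω‖ / |ω.im|) (by positivity)
      (by filter_upwards [hn] with t ht; rw [norm_neg, ht, e]) hb hp.neg hq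
      (fun j hj => by
        have := (hξ (j + 1) (by omega) (by omega)).2
        rwa [neg_div, sub_neg_eq_add])
      (fun t => by
        convert hz (t * ω) using 1
        · funext x; simp only [pencilPotential]; ring
        · funext x; simp only [jumpCoeff]; ring)
      (fun t => h0 _) (fun t => h0' _) hj hx
    obtain ⟨⟨C, hC, h1⟩, h2⟩ := H
    refine ⟨key C hC (by simpa only [e, norm_neg] using h1), h2.congr fun t => ?_⟩
    rw [Real.sign_of_neg h]
    push_cast; ring
  · have e : ∀ t : ℝ, ((t : ℂ) * ω).im = t * |ω.im| := fun t => by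
      simp [abs_of_pos h]
    have H := dirichlet_asymptotics (l := atTop) (r := fun t : ℝ => (t : ℂ) * ω)
      (p := p) (η' := η') (η := η) (γ := γ) (q := q) (N := N) (b := b)
      (z := fun t => z (t * ω)) (z' := fun t => z' (t * ω))
      (by simpa only [e] using hlim) (K := ‖ω‖ / |ω.im|) (by positivity)
      (by filter_upwards [hn] with t ht; rw [ht, e]) hb hp hq
      (fun j hj => (hξ (j + 1) (by omega) (by omega)).1)
      (fun t => hz _) (fun t => h0 _) (fun t => h0' _) hj hx
    obtain ⟨⟨C, hC, h1⟩, h2⟩ := H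
    refine ⟨key C hC (by simpa only [e] using h1), h2.congr fun t => ?_⟩
    rw [Real.sign_of_pos h]
    push_cast; ring

/-- Asymptotics along a non-real ray of the solutions with jumps vanishing at the right end. -/
theorem dirichlet_ray_right {z z' : ℂ → ℕ → ℝ → ℂ} {ω : ℂ} (hω : ω.im ≠ 0)
    (hb : ∀ j < N, b j < b (j + 1)) (hγ : ∀ j, 1 ≤ j → j + 1 ≤ N → γ j ≠ 0)
    (hp : IsPrimitiveOn p p' (b 0) (b N)) (hq : IntervalIntegrable q volume (b 0) (b N))
    (hξ : ∀ j, 1 ≤ j → j + 1 ≤ N →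
      (γ j + (γ j)⁻¹) / 2 - η' j / 2 ≠ 0 ∧ (γ j + (γ j)⁻¹) / 2 + η' j / 2 ≠ 0)
    (hz : ∀ ρ, PieceSol N b (pencilPotential p q ρ) γ (jumpCoeff η' η ρ) (z ρ) (z' ρ))
    (h0 : ∀ ρ, z ρ (N - 1) (b N) = 0) (h0' : ∀ ρ, ‖z' ρ (N - 1) (b N)‖ = 1)
    {j : ℕ} (hj : j < N) {x : ℝ} (hx : x ∈ Ico (b j) (b (j + 1))) :
    (∃ C > 0, ∀ᶠ t : ℝ in atTop,
      Real.exp (t * |ω.im| * (b N - x)) ≤ C * (t * ‖z (t * ω) j x‖) ∧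
      t * ‖z (t * ω) j x‖ ≤ C * Real.exp (t * |ω.im| * (b N - x))) ∧
    Tendsto (fun t : ℝ => z' (t * ω) j x / z (t * ω) j x -
      Real.sign ω.im * (Complex.I * (t * ω + p x / 2))) atTop (𝓝 0) := by
  have H := dirichlet_ray (N := N) (b := fun j => b N - b (N - j)) (p := fun x => p (b N - x))
    (p' := fun x => -p' (b N - x)) (q := fun x => q (b N - x)) (γ := fun j => (γ (N - j))⁻¹)
    (η' := fun j => η' (N - j)) (η := fun j => η (N - j))
    (z := fun ρ j x => z ρ (N - 1 - j) (b N - x))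
    (z' := fun ρ j x => -z' ρ (N - 1 - j) (b N - x)) hω
    (fun j hj => by
      have := hb (N - (j + 1)) (by omega)
      rw [show N - (j + 1) + 1 = N - j by omega] at this
      linarith)
    (by simpa using hp.reflect (b N))
    (by simpa using (hq.comp_sub_left (b N)).symm)
    (fun j h1 h2 => by
      have := hξ (N - j) (by omega) (by omega)
      rwa [inv_inv, add_comm (γ (N - j))⁻¹])
    (fun ρ => (hz ρ).reflect (b N) hγ)
    (fun ρ => by simpa using h0 ρ) (fun ρ => by simpa using h0' ρ)
    (j := N - 1 - j) (by omega) (x := b N - x)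
    (by
      rw [show N - (N - 1 - j) = j + 1 by omega, show N - (N - 1 - j + 1) = j by omega]
      exact ⟨by linarith [hx.2], by linarith [hx.1]⟩)
  simp only [sub_sub_cancel, show N - 1 - (N - 1 - j) = j by omega, tsub_zero,
    sub_self] at H
  refine ⟨H.1, ?_⟩
  have := H.2.neg
  rw [neg_zero] at this
  refine this.congr fun t => ?_
  ring

end PieceSol

/-- A zero-free bounded entire function is bounded below on a smaller disc. -/
theorem exists_lower_bound_of_ne_zero {D : ℂ → ℂ} (hD : Differentiable ℂ D) {A r s : ℝ}
    (hr : 3 * s ≤ 2 * r) (hr0 : 0 < r)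
    (hA : ∀ z, ‖z‖ < r → ‖D z‖ ≤ A) (h0 : ∀ z, ‖z‖ < r → D z ≠ 0) {w : ℂ} (hw : ‖w‖ ≤ s) :
    ‖D 0‖ ≤ Real.exp 4 * (A / ‖D 0‖) ^ 4 * ‖D w‖ := by
  have hD0 : 0 < ‖D 0‖ := norm_pos_iff.2 (h0 0 (by simpa using hr0))
  have hA0 : ‖D 0‖ ≤ A := hA 0 (by simpa using hr0)
  have hA' : 0 < A := hD0.trans_le hA0
  have hmem : ∀ z : ℂ, z ∈ Metric.ball (0 : ℂ) r ↔ ‖z‖ < r := fun z => mem_ball_zero_iff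
  have hq : DifferentiableOn ℂ (fun z => deriv D z / D z) (Metric.ball 0 r) := by
    refine DifferentiableOn.div ?_ hD.differentiableOn fun z hz => h0 z ((hmem z).1 hz)
    exact (hD.differentiableOn (s := univ)).deriv isOpen_univ |>.mono (subset_univ _)
  obtain ⟨g, hg⟩ := hq.isExactOn_ball
  have hconst : ∀ z ∈ Metric.ball (0 : ℂ) r, D z * Complex.exp (-g z) = D 0 * Complex.exp (-g 0) := by
    intro z hz
    refine (convex_ball (0 : ℂ) r).is_const_of_fderivWithin_eq_zero (𝕜 := ℂ)
      (f := fun z => D z * Complex.exp (-g z)) (fun y hy => ?_) (fun y hy => ?_) hz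
      (Metric.mem_ball_self hr0)
    · exact (hD.differentiableAt.mul (hg y hy).differentiableAt.neg.cexp).differentiableWithinAt
    · have h1 := (hD y).hasDerivAt.mul (hg y hy).neg.cexp
      have h2 : HasDerivAt (fun z => D z * Complex.exp (-g z)) 0 y := by
        refine h1.congr_deriv ?_
        have := h0 y ((hmem y).1 hy)
        rw [mul_neg, mul_neg, mul_left_comm, mul_div_cancel₀ _ this]
        simp [mul_comm]
      have h3 := h2.hasFDerivAt.hasFDerivWithinAt.fderivWithin
        (Metric.isOpen_ball.uniqueDiffWithinAt hy)
      rw [h3]; ext; simp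
  have hexp : ∀ z ∈ Metric.ball (0 : ℂ) r, D z = D 0 * Complex.exp (g z - g 0) := by
    intro z hz
    rw [sub_eq_add_neg, Complex.exp_add, mul_left_comm, ← hconst z hz, mul_left_comm,
      ← Complex.exp_add]
    simp
  have hnorm : ∀ z ∈ Metric.ball (0 : ℂ) r, ‖D z‖ = ‖D 0‖ * Real.exp (g z - g 0).re := by
    intro z hz
    rw [hexp z hz, norm_mul, Complex.norm_exp]
  set L := Real.log (A / ‖D 0‖) with hL
  have hL0 : 0 ≤ L := Real.log_nonneg ((one_le_div hD0).2 hA0)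
  have hexpL : Real.exp L = A / ‖D 0‖ := Real.exp_log (by positivity)
  have hwr : ‖w‖ < r := by nlinarith
  have hB := Complex.borelCaratheodory_zero (M := L + 1) (R := r) (f := fun z => g z - g 0)
    (by linarith) (fun y hy => ((hg y hy).differentiableAt.sub_const _).differentiableWithinAt)
    (fun z hz => by
      have h1 := hnorm z hz ▸ hA z ((hmem z).1 hz)
      have h2 : Real.exp (g z - g 0).re ≤ Real.exp L := by
        rw [hexpL, le_div_iff₀ hD0]; linarith
      have := Real.exp_le_exp.1 h2
      simp only [mem_ofPred_eq]; linarith) hr0 ((hmem w).2 hwr) (sub_self _)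
  have hB' : ‖g w - g 0‖ ≤ 4 * (L + 1) := by
    refine hB.trans ?_
    rw [div_le_iff₀ (by linarith)]
    nlinarith
  have hre : -(4 * (L + 1)) ≤ (g w - g 0).re := by
    have := (abs_le.1 ((Complex.abs_re_le_norm (g w - g 0)).trans hB')).1
    linarith
  rw [hnorm w ((hmem w).2 hwr), ← hexpL, ← Real.exp_nat_mul, ← Real.exp_add]
  have : 1 ≤ Real.exp (4 + (4 : ℕ) * L) * Real.exp (g w - g 0).re := by
    rw [← Real.exp_add]
    refine Real.one_le_exp ?_
    push_cast; linarith
  nlinarith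

/-- Division estimate: an entire function `F` is controlled by bounds of `D` and `F * D`. -/
theorem norm_le_of_norm_mul_le {F : ℂ → ℂ} (hF : Differentiable ℂ F) {A B R : ℝ} (hR : 0 < R)
    (n : ℕ) : ∀ D : ℂ → ℂ, Differentiable ℂ D → D 0 ≠ 0 → (∀ z, ‖z‖ ≤ R → ‖D z‖ ≤ A) →
    (∀ z, ‖z‖ ≤ R → ‖F z * D z‖ ≤ B) → A < ‖D 0‖ * (4 / 3) ^ n → ∀ w, ‖w‖ ≤ R / 2 →
    ‖F w‖ ≤ Real.exp 4 * (A / ‖D 0‖) ^ 4 * (B / ‖D 0‖) := by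
  induction n with
  | zero =>
    intro D _ _ hA _ h
    have := hA 0 (by simpa using hR.le)
    simp at h
    linarith
  | succ n ih =>
    intro D hD h0 hA hB h w hw
    have hD0 := norm_pos_iff.2 h0
    have hA0 : ‖D 0‖ ≤ A := hA 0 (by simpa using hR.le)
    have hB0 : 0 ≤ B := (norm_nonneg _).trans (hB 0 (by simpa using hR.le))
    by_cases hz : ∃ u, ‖u‖ ≤ 3 / 4 * R ∧ D u = 0
    · obtain ⟨u, hu, hDu⟩ := hz
      have hu0 : u ≠ 0 := fun h => h0 (h ▸ hDu)
      have hun := norm_pos_iff.2 hu0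
      set D₁ : ℂ → ℂ := fun z => dslope D u z * ((R ^ 2 - (starRingEnd ℂ) u * z) / R) with hD₁
      have hds : Differentiable ℂ (dslope D u) := by
        rw [← differentiableOn_univ]
        exact (Complex.differentiableOn_dslope univ_mem).2 hD.differentiableOn
      have hD₁d : Differentiable ℂ D₁ := by
        refine hds.mul ?_
        fun_prop
      have hslope : ∀ z, (z - u) * dslope D u z = D z := fun z => by
        have := sub_smul_dslope D u z
        simpa [hDu] using this
      have hcirc : ∀ z, ‖z‖ = R → ‖D₁ z‖ = ‖D z‖ := by
        intro z hz
        have e : (R : ℂ) ^ 2 = z * (starRingEnd ℂ) z := by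
          rw [Complex.mul_conj, Complex.normSq_eq_norm_sq, hz]; push_cast; ring
        have e2 : (R : ℂ) ^ 2 - (starRingEnd ℂ) u * z = z * (starRingEnd ℂ) (z - u) := by
          rw [e, map_sub]; ring
        rw [hD₁, ← hslope z]
        simp only [norm_mul, norm_div, e2, RCLike.norm_conj, Complex.norm_real,
          Real.norm_of_nonneg hR.le, hz]
        field_simp
      have hmax : ∀ f : ℂ → ℂ, Differentiable ℂ f → ∀ C, (∀ z, ‖z‖ = R → ‖f z‖ ≤ C) →
          ∀ z, ‖z‖ ≤ R → ‖f z‖ ≤ C := by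
        intro f hf C hC z hz
        refine Complex.norm_le_of_forall_mem_frontier_norm_le (U := Metric.ball 0 R)
          Metric.isBounded_ball hf.diffContOnCl (fun y hy => ?_) ?_
        · rw [frontier_ball _ hR.ne'] at hy
          exact hC y (by simpa using hy)
        · rw [closure_ball _ hR.ne']
          simpa using hz
      have hD₁0 : ‖D₁ 0‖ * ‖u‖ = ‖D 0‖ * R := by
        rw [hD₁, ← hslope 0]
        simp only [norm_mul, norm_div, mul_zero, sub_zero, zero_sub, norm_neg, norm_pow,
          Complex.norm_real, Real.norm_of_nonneg hR.le]
        field_simp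
      have hge : ‖D 0‖ * (4 / 3) ≤ ‖D₁ 0‖ := by
        nlinarith [norm_nonneg (D₁ 0)]
      have hpos : 0 < ‖D₁ 0‖ := by linarith
      refine (ih D₁ hD₁d (norm_pos_iff.1 hpos)
        (hmax _ hD₁d _ fun z hz => (hcirc z hz).trans_le (hA z hz.le))
        (hmax _ (hF.mul hD₁d) _ fun z hz => by
          rw [Pi.mul_apply, norm_mul, hcirc z hz, ← norm_mul]; exact hB z hz.le)
        (h.trans_le ?_) w hw).trans ?_
      · rw [pow_succ]
        have : (0 : ℝ) ≤ (4 / 3) ^ n := by positivity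
        nlinarith
      · have : ‖D 0‖ ≤ ‖D₁ 0‖ := by linarith
        have : 0 ≤ A := hD0.le.trans hA0
        gcongr
    · push Not at hz
      have h1 := exists_lower_bound_of_ne_zero hD (A := A) (r := 3 / 4 * R) (s := R / 2)
        (by linarith) (by positivity) (fun z hz => hA z (by linarith))
        (fun z h => hz z h.le) hw
      have h2 := hB w (by linarith)
      rw [norm_mul] at h2
      rw [← mul_div_assoc, le_div_iff₀ hD0]
      calc ‖F w‖ * ‖D 0‖ ≤ ‖F w‖ * (Real.exp 4 * (A / ‖D 0‖) ^ 4 * ‖D w‖) := by gcongr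
        _ = Real.exp 4 * (A / ‖D 0‖) ^ 4 * (‖F w‖ * ‖D w‖) := by ring
        _ ≤ _ := by
          have : 0 ≤ A := hD0.le.trans hA0
          gcongr

/-- Functions of at most exponential growth. -/
def ExpType (f : ℂ → ℂ) : Prop :=
  ∃ K a : ℝ, 0 ≤ K ∧ 0 ≤ a ∧ ∀ z, ‖f z‖ ≤ K * Real.exp (a * ‖z‖)

namespace ExpType

variable {f g : ℂ → ℂ}

theorem mul (hf : ExpType f) (hg : ExpType g) : ExpType (fun z => f z * g z) := by
  obtain ⟨K, a, hK, ha, h⟩ := hf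
  obtain ⟨L, c, hL, hc, h'⟩ := hg
  refine ⟨K * L, a + c, by positivity, by positivity, fun z => ?_⟩
  rw [norm_mul, add_mul, Real.exp_add]
  calc _ ≤ (K * Real.exp (a * ‖z‖)) * (L * Real.exp (c * ‖z‖)) :=
        mul_le_mul (h z) (h' z) (norm_nonneg _) (by positivity)
    _ = _ := by ring

theorem sub (hf : ExpType f) (hg : ExpType g) : ExpType (fun z => f z - g z) := by
  obtain ⟨K, a, hK, ha, h⟩ := hf
  obtain ⟨L, c, hL, hc, h'⟩ := hg
  refine ⟨K + L, a + c, by positivity, by positivity, fun z => ?_⟩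
  have h1 : Real.exp (a * ‖z‖) ≤ Real.exp ((a + c) * ‖z‖) := by gcongr; linarith
  have h2 : Real.exp (c * ‖z‖) ≤ Real.exp ((a + c) * ‖z‖) := by gcongr; linarith
  calc _ ≤ ‖f z‖ + ‖g z‖ := norm_sub_le _ _
    _ ≤ K * Real.exp (a * ‖z‖) + L * Real.exp (c * ‖z‖) := add_le_add (h z) (h' z)
    _ ≤ K * Real.exp ((a + c) * ‖z‖) + L * Real.exp ((a + c) * ‖z‖) := by gcongr
    _ = _ := by ring

/-- Exponential growth is inherited by an entire quotient. -/
theorem of_mul {F D : ℂ → ℂ} (hF : Differentiable ℂ F) (hD : Differentiable ℂ D)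
    (hDt : ExpType D) (hFD : ExpType (fun z => F z * D z)) {c : ℂ} (hc : D c ≠ 0) :
    ExpType F := by
  obtain ⟨K, a, hK, ha, h⟩ := hDt
  obtain ⟨L, e, hL, he, h'⟩ := hFD
  have hD0 := norm_pos_iff.2 hc
  have key : ∀ R > 0, ∀ w, ‖w‖ ≤ R / 2 → ‖F (c + w)‖ ≤ Real.exp 4 *
      ((K * Real.exp (a * (‖c‖ + R))) / ‖D c‖) ^ 4 * ((L * Real.exp (e * (‖c‖ + R))) / ‖D c‖) := by
    intro R hR w hw
    obtain ⟨n, hn⟩ := pow_unbounded_of_one_lt ((K * Real.exp (a * (‖c‖ + R))) / ‖D c‖)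
      (show (1 : ℝ) < 4 / 3 by norm_num)
    rw [div_lt_iff₀' hD0] at hn
    have hcn : ∀ z, ‖z‖ ≤ R → ‖c + z‖ ≤ ‖c‖ + R := fun z hz => (norm_add_le _ _).trans (by linarith)
    have := norm_le_of_norm_mul_le (F := fun z => F (c + z)) (hF.comp (by fun_prop)) hR n
      (fun z => D (c + z)) (hD.comp (by fun_prop)) (by simpa using hc)
      (A := K * Real.exp (a * (‖c‖ + R))) (B := L * Real.exp (e * (‖c‖ + R)))
      (fun z hz => (h _).trans (by gcongr; exact hcn z hz))
      (fun z hz => (h' _).trans (by gcongr; exact hcn z hz)) (by simpa using hn) w hw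
    simpa using this
  refine ⟨Real.exp 4 * (K * Real.exp (a * (3 * ‖c‖ + 1)) / ‖D c‖) ^ 4 *
    (L * Real.exp (e * (3 * ‖c‖ + 1)) / ‖D c‖), 4 * (2 * a) + 2 * e, by positivity, by positivity,
    fun z => ?_⟩
  have hle := norm_sub_le z c
  have := key (2 * (‖z‖ + ‖c‖) + 1) (by positivity) (z - c) (by linarith)
  rw [add_sub_cancel] at this
  refine this.trans (le_of_eq ?_)
  rw [show a * (‖c‖ + (2 * (‖z‖ + ‖c‖) + 1)) = a * (3 * ‖c‖ + 1) + 2 * a * ‖z‖ by ring,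
    show e * (‖c‖ + (2 * (‖z‖ + ‖c‖) + 1)) = e * (3 * ‖c‖ + 1) + 2 * e * ‖z‖ by ring,
    show (4 * (2 * a) + 2 * e) * ‖z‖ = (4 : ℕ) * (2 * a * ‖z‖) + 2 * e * ‖z‖ by push_cast; ring,
    Real.exp_add, Real.exp_add, Real.exp_add, Real.exp_nat_mul]
  ring

/-- Phragmén–Lindelöf in a quarter plane. -/
theorem norm_le_of_quadrant (hd : Differentiable ℂ f) (hf : ExpType f) {ω : ℂ} {C : ℝ}
    (h1 : ∀ t : ℝ, 0 ≤ t → ‖f (t * ω)‖ ≤ C) (h2 : ∀ t : ℝ, 0 ≤ t → ‖f (t * (ω * I))‖ ≤ C)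
    {z : ℂ} (hre : 0 ≤ z.re) (him : 0 ≤ z.im) : ‖f (z * ω)‖ ≤ C := by
  obtain ⟨K, a, hK, ha, h⟩ := hf
  refine PhragmenLindelof.quadrant_I (f := fun z => f (z * ω))
    (hd.comp (by fun_prop)).diffContOnCl ⟨1, by norm_num, a * ‖ω‖, ?_⟩ h1 (fun t ht => ?_) hre him
  · refine Asymptotics.IsBigO.of_bound K (Eventually.of_forall fun z => ?_)
    rw [Real.rpow_one, Real.norm_of_nonneg (Real.exp_pos _).le]
    refine (h _).trans (le_of_eq ?_)
    rw [norm_mul]; ring_nf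
  · have := h2 t ht
    rwa [show (t : ℂ) * I * ω = t * (ω * I) by ring]

/-- An entire function of exponential growth with limits along four perpendicular rays is
constant. -/
theorem eq_of_tendsto_rays (hd : Differentiable ℂ f) (hf : ExpType f) {ω : ℂ} (hω : ω ≠ 0)
    {L : ℕ → ℂ}
    (hL : ∀ k < 4, Tendsto (fun t : ℝ => f (t * (ω * I ^ k))) atTop (𝓝 (L k))) :
    ∀ k < 4, ∀ z, f z = L k := by
  have hbd : ∀ k < 4, ∃ C, ∀ t : ℝ, 0 ≤ t → ‖f (t * (ω * I ^ k))‖ ≤ C := by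
    intro k hk
    have h1 := ((hL k hk).norm.eventually (gt_mem_nhds (lt_add_one ‖L k‖)))
    obtain ⟨t₀, ht₀⟩ := eventually_atTop.1 h1
    obtain ⟨C, hC⟩ := (isCompact_Icc (a := (0 : ℝ)) (b := t₀)).exists_bound_of_continuousOn
      (f := fun t : ℝ => f (t * (ω * I ^ k)))
      (hd.continuous.comp (by fun_prop)).continuousOn
    refine ⟨max C (‖L k‖ + 1), fun t ht => ?_⟩
    rcases le_total t t₀ with h | h
    · exact (hC t ⟨ht, h⟩).trans (le_max_left _ _)
    · exact (ht₀ t h).le.trans (le_max_right _ _)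
  choose! C hC using hbd
  set B := max (max (C 0) (C 1)) (max (C 2) (C 3)) with hB
  have hCB : ∀ k < 4, ∀ t : ℝ, 0 ≤ t → ‖f (t * (ω * I ^ k))‖ ≤ B := by
    intro k hk t ht
    refine (hC k hk t ht).trans ?_
    interval_cases k <;> simp [hB]
  have hquad : ∀ k < 4, ∀ z : ℂ, 0 ≤ z.re → 0 ≤ z.im → ‖f (z * (ω * I ^ k))‖ ≤ B := by
    intro k hk z h1 h2
    refine norm_le_of_quadrant hd hf (hCB k hk) (fun t ht => ?_) h1 h2
    rcases Nat.lt_or_ge (k + 1) 4 with h | h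
    · have := hCB (k + 1) h t ht
      rwa [pow_succ, ← mul_assoc ω] at this
    · have h3 : k = 3 := by omega
      have := hCB 0 (by norm_num) t ht
      subst h3
      rwa [mul_assoc, ← pow_succ, I_pow_four, ← pow_zero I]
  have hall : ∀ z, ‖f z‖ ≤ B := by
    intro z
    set w := z / ω with hw
    have hz : z = w * ω := by rw [hw]; field_simp
    have e0 : w * ω = w * (ω * I ^ 0) := by simp
    have e1 : w * ω = (-I * w) * (ω * I ^ 1) := by
      linear_combination (w * ω) * I_sq
    have e2 : w * ω = (-w) * (ω * I ^ 2) := by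
      linear_combination (w * ω) * I_sq
    have e3 : w * ω = (I * w) * (ω * I ^ 3) := by
      linear_combination (-w * ω) * I_pow_four
    rw [hz]
    rcases le_total 0 w.re with h1 | h1 <;> rcases le_total 0 w.im with h2 | h2
    · rw [e0]; exact hquad 0 (by norm_num) _ h1 h2
    · rw [e3]; exact hquad 3 (by norm_num) _ (by simpa using h2) (by simpa using h1)
    · rw [e1]; exact hquad 1 (by norm_num) _ (by simpa using h2) (by simpa using h1)
    · rw [e2]; exact hquad 2 (by norm_num) _ (by simpa using h1) (by simpa using h2)
  have hconst := hd.apply_eq_apply_of_bounded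
    (isBounded_iff_forall_norm_le.2 ⟨B, by rintro _ ⟨z, rfl⟩; exact hall z⟩)
  intro k hk z
  refine tendsto_nhds_unique ?_ (hL k hk)
  exact tendsto_const_nhds.congr fun t => hconst _ _

end ExpType

/-- The sine-type family `s` and the cosine-type family `c` of solutions with jumps of a pencil
whose data satisfy the regularity and non-degeneracy conditions. -/
structure FundamentalSystem (N : ℕ) (b : ℕ → ℝ) (p p' q : ℝ → ℂ) (γ η' η : ℕ → ℂ)
    (s s' c c' : ℂ → ℕ → ℝ → ℂ) : Prop where
  pos : 1 ≤ N
  node_lt : ∀ j < N, b j < b (j + 1)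
  ne_zero : ∀ j, 1 ≤ j → j + 1 ≤ N → γ j ≠ 0
  nondeg : ∀ j, 1 ≤ j → j + 1 ≤ N →
    (γ j + (γ j)⁻¹) / 2 - η' j / 2 ≠ 0 ∧ (γ j + (γ j)⁻¹) / 2 + η' j / 2 ≠ 0
  prim : IsPrimitiveOn p p' (b 0) (b N)
  integrable : IntervalIntegrable q volume (b 0) (b N)
  sine : ∀ ρ, PieceSol N b (pencilPotential p q ρ) γ (jumpCoeff η' η ρ) (s ρ) (s' ρ)
  cosine : ∀ ρ, PieceSol N b (pencilPotential p q ρ) γ (jumpCoeff η' η ρ) (c ρ) (c' ρ)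
  sine_zero : ∀ ρ, s ρ 0 (b 0) = 0
  sine'_zero : ∀ ρ, s' ρ 0 (b 0) = 1
  cosine_zero : ∀ ρ, c ρ 0 (b 0) = 1
  cosine'_zero : ∀ ρ, c' ρ 0 (b 0) = 0

namespace FundamentalSystem

variable {N : ℕ} {b : ℕ → ℝ} {p p' q : ℝ → ℂ} {γ η' η : ℕ → ℂ} {s s' c c' : ℂ → ℕ → ℝ → ℂ}

theorem continuousOn (H : FundamentalSystem N b p p' q γ η' η s s' c c') :
    ContinuousOn p (Icc (b 0) (b N)) :=
  H.prim.continuousOn (node_le_node H.node_lt (Nat.zero_le N) le_rfl)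

theorem last_mem (H : FundamentalSystem N b p p' q γ η' η s s' c c') :
    b N ∈ Icc (b (N - 1)) (b (N - 1 + 1)) := by
  have h := H.node_lt (N - 1) (by have := H.pos; omega)
  rw [Nat.sub_add_cancel H.pos] at h ⊢
  exact ⟨h.le, le_rfl⟩

theorem pred_lt (H : FundamentalSystem N b p p' q γ η' η s s' c c') :
    N - 1 < N := Nat.sub_one_lt_of_lt H.pos

theorem wronskian (H : FundamentalSystem N b p p' q γ η' η s s' c c')
    (ρ : ℂ) {j : ℕ} (hj : j < N) {x : ℝ} (hx : x ∈ Icc (b j) (b (j + 1))) :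
    c ρ j x * s' ρ j x - c' ρ j x * s ρ j x = 1 := by
  rw [(H.cosine ρ).wronskian_eq (H.sine ρ) H.node_lt H.ne_zero hj x hx, H.cosine_zero,
    H.cosine'_zero, H.sine'_zero]
  ring

theorem differentiable_sine (H : FundamentalSystem N b p p' q γ η' η s s' c c')
    {j : ℕ} (hj : j < N) {x : ℝ} (hx : x ∈ Icc (b j) (b (j + 1))) :
    Differentiable ℂ fun ρ => s ρ j x :=
  (PieceSol.differentiable H.node_lt H.ne_zero H.continuousOn H.integrable H.sine H.cosine H.sine
    (fun ρ => by rw [H.cosine_zero, H.cosine'_zero, H.sine'_zero]; ring)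
    (by simp only [H.sine_zero]; fun_prop) (by simp only [H.sine'_zero]; fun_prop) hj x hx).1

theorem differentiable_cosine (H : FundamentalSystem N b p p' q γ η' η s s' c c')
    {j : ℕ} (hj : j < N) {x : ℝ} (hx : x ∈ Icc (b j) (b (j + 1))) :
    Differentiable ℂ fun ρ => c ρ j x :=
  (PieceSol.differentiable H.node_lt H.ne_zero H.continuousOn H.integrable H.cosine H.cosine H.sine
    (fun ρ => by rw [H.cosine_zero, H.cosine'_zero, H.sine'_zero]; ring)
    (by simp only [H.cosine_zero]; fun_prop) (by simp only [H.cosine'_zero]; fun_prop) hj x hx).1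

theorem expType_of_initial (H : FundamentalSystem N b p p' q γ η' η s s' c c')
    {z z' : ℂ → ℕ → ℝ → ℂ}
    (hz : ∀ ρ, PieceSol N b (pencilPotential p q ρ) γ (jumpCoeff η' η ρ) (z ρ) (z' ρ))
    (h : ∀ ρ, (1 + ‖ρ‖) * ‖z ρ 0 (b 0)‖ + ‖z' ρ 0 (b 0)‖ ≤ 1 + ‖ρ‖)
    {j : ℕ} (hj : j < N) {x : ℝ} (hx : x ∈ Icc (b j) (b (j + 1))) :
    ExpType fun ρ => z ρ j x := by
  obtain ⟨K, B, hK, hB, hg⟩ := PieceSol.growth (γ := γ) (η' := η') (η := η) H.node_lt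
    H.continuousOn H.integrable hj
  refine ⟨K * Real.exp B, B, by positivity, hB, fun ρ => ?_⟩
  have h1 := hg ρ (z ρ) (z' ρ) (hz ρ) x hx
  have h2 : (1 + ‖ρ‖) * ‖z ρ j x‖ ≤ (1 + ‖ρ‖) * (K * Real.exp (B * (1 + ‖ρ‖))) :=
    ((le_add_of_nonneg_right (norm_nonneg _)).trans h1).trans
      (mul_le_mul_of_nonneg_right (h ρ) (by positivity))
  have h3 := le_of_mul_le_mul_left h2 (by positivity)
  rwa [mul_add, mul_one, Real.exp_add, ← mul_assoc] at h3

theorem expType_sine (H : FundamentalSystem N b p p' q γ η' η s s' c c')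
    {j : ℕ} (hj : j < N) {x : ℝ} (hx : x ∈ Icc (b j) (b (j + 1))) :
    ExpType fun ρ => s ρ j x :=
  H.expType_of_initial H.sine (fun ρ => by simp [H.sine_zero, H.sine'_zero]) hj hx

theorem expType_cosine (H : FundamentalSystem N b p p' q γ η' η s s' c c')
    {j : ℕ} (hj : j < N) {x : ℝ} (hx : x ∈ Icc (b j) (b (j + 1))) :
    ExpType fun ρ => c ρ j x :=
  H.expType_of_initial H.cosine (fun ρ => by simp [H.cosine_zero, H.cosine'_zero]) hj hx

/-- Ray asymptotics of the solution vanishing at the right end. -/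
theorem right_ray (H : FundamentalSystem N b p p' q γ η' η s s' c c')
    {ω : ℂ} (hω : ω.im ≠ 0) {j : ℕ} (hj : j < N) {x : ℝ}
    (hx : x ∈ Ico (b j) (b (j + 1))) :
    (∃ C > 0, ∀ᶠ t : ℝ in atTop,
      Real.exp (t * |ω.im| * (b N - x)) ≤ C * (t * ‖c (t * ω) (N - 1) (b N) * s (t * ω) j x +
        -s (t * ω) (N - 1) (b N) * c (t * ω) j x‖) ∧
      t * ‖c (t * ω) (N - 1) (b N) * s (t * ω) j x +
        -s (t * ω) (N - 1) (b N) * c (t * ω) j x‖ ≤ C * Real.exp (t * |ω.im| * (b N - x))) ∧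
    Tendsto (fun t : ℝ => (c (t * ω) (N - 1) (b N) * s' (t * ω) j x +
        -s (t * ω) (N - 1) (b N) * c' (t * ω) j x) / (c (t * ω) (N - 1) (b N) * s (t * ω) j x +
        -s (t * ω) (N - 1) (b N) * c (t * ω) j x) -
      Real.sign ω.im * (Complex.I * (t * ω + p x / 2))) atTop (𝓝 0) :=
  PieceSol.dirichlet_ray_right
    (z := fun ρ j x => c ρ (N - 1) (b N) * s ρ j x + -s ρ (N - 1) (b N) * c ρ j x)
    (z' := fun ρ j x => c ρ (N - 1) (b N) * s' ρ j x + -s ρ (N - 1) (b N) * c' ρ j x)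
    hω H.node_lt H.ne_zero H.prim H.integrable H.nondeg
    (fun ρ => (H.sine ρ).lin (H.cosine ρ) _ _ H.node_lt) (fun ρ => by ring)
    (fun ρ => by
      have := H.wronskian ρ H.pred_lt H.last_mem
      rw [show c ρ (N - 1) (b N) * s' ρ (N - 1) (b N) + -s ρ (N - 1) (b N) * c' ρ (N - 1) (b N) = 1
        by linear_combination this, norm_one]) hj hx

theorem zero_mem (H : FundamentalSystem N b p p' q γ η' η s s' c c') :
    b 0 ∈ Ico (b 0) (b (0 + 1)) := ⟨le_rfl, H.node_lt 0 H.pos⟩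

/-- The characteristic function is exponentially large along non-real rays. -/
theorem exp_le_characteristic (H : FundamentalSystem N b p p' q γ η' η s s' c c')
    {ω : ℂ} (hω : ω.im ≠ 0) : ∃ C > 0, ∀ᶠ t : ℝ in atTop,
    Real.exp (t * |ω.im| * (b N - b 0)) ≤ C * (t * ‖s (t * ω) (N - 1) (b N)‖) := by
  obtain ⟨⟨C, hC, h⟩, -⟩ := H.right_ray hω H.pos H.zero_mem
  refine ⟨C, hC, h.mono fun t ht => ?_⟩
  simpa [H.sine_zero, H.cosine_zero] using ht.1

theorem characteristic_ne_zero (H : FundamentalSystem N b p p' q γ η' η s s' c c')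
    {ω : ℂ} (hω : ω.im ≠ 0) :
    ∀ᶠ t : ℝ in atTop, s (t * ω) (N - 1) (b N) ≠ 0 := by
  obtain ⟨C, hC, h⟩ := H.exp_le_characteristic hω
  filter_upwards [h] with t ht h0
  rw [h0, norm_zero, mul_zero, mul_zero] at ht
  exact absurd ht (not_le.2 (Real.exp_pos _))

/-- Asymptotics of the Weyl-type function along non-real rays. -/
theorem weyl_ray (H : FundamentalSystem N b p p' q γ η' η s s' c c')
    {ω : ℂ} (hω : ω.im ≠ 0) :
    Tendsto (fun t : ℝ => -c (t * ω) (N - 1) (b N) / s (t * ω) (N - 1) (b N) -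
      Real.sign ω.im * (Complex.I * (t * ω + p (b 0) / 2))) atTop (𝓝 0) := by
  have h := (H.right_ray hω H.pos H.zero_mem).2
  refine h.congr fun t => ?_
  rw [H.sine_zero, H.cosine_zero, H.sine'_zero, H.cosine'_zero]
  simp only [mul_zero, mul_one, add_zero, zero_add, div_neg, neg_div]

theorem sine_ray (H : FundamentalSystem N b p p' q γ η' η s s' c c')
    {ω : ℂ} (hω : ω.im ≠ 0) {j : ℕ} (hj : j < N) {x : ℝ}
    (hx : x ∈ Ioo (b j) (b (j + 1))) : ∃ C > 0, ∀ᶠ t : ℝ in atTop,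
    t * ‖s (t * ω) j x‖ ≤ C * Real.exp (t * |ω.im| * (x - b 0)) := by
  obtain ⟨⟨C, hC, h⟩, -⟩ := PieceSol.dirichlet_ray hω H.node_lt H.prim H.integrable H.nondeg
    H.sine H.sine_zero (fun ρ => by rw [H.sine'_zero, norm_one]) hj (Ioo_subset_Ioc_self hx)
  exact ⟨C, hC, h.mono fun t ht => ht.2⟩

/-- Decay of the Weyl solution along non-real rays. -/
theorem weylSolution_ray (H : FundamentalSystem N b p p' q γ η' η s s' c c')
    {ω : ℂ} (hω : ω.im ≠ 0) {j : ℕ} (hj : j < N) {x : ℝ}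
    (hx : x ∈ Ioo (b j) (b (j + 1))) : ∃ C > 0, ∀ᶠ t : ℝ in atTop,
    ‖c (t * ω) j x + -c (t * ω) (N - 1) (b N) / s (t * ω) (N - 1) (b N) * s (t * ω) j x‖ ≤
      C * Real.exp (-(t * |ω.im| * (x - b 0))) := by
  obtain ⟨⟨C, hC, h⟩, -⟩ := H.right_ray hω hj (Ioo_subset_Ico_self hx)
  obtain ⟨D, hD, hd⟩ := H.exp_le_characteristic hω
  refine ⟨C * D, by positivity, ?_⟩
  filter_upwards [h, hd, H.characteristic_ne_zero hω, eventually_gt_atTop 0] with t h1 h2 h3 ht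
  have h4 := norm_pos_iff.2 h3
  rw [show c (t * ω) j x + -c (t * ω) (N - 1) (b N) / s (t * ω) (N - 1) (b N) * s (t * ω) j x =
    -((c (t * ω) (N - 1) (b N) * s (t * ω) j x + -s (t * ω) (N - 1) (b N) * c (t * ω) j x) /
      s (t * ω) (N - 1) (b N)) by field_simp; ring, norm_neg, norm_div, div_le_iff₀ h4]
  generalize ‖c (t * ω) (N - 1) (b N) * s (t * ω) j x +
    -s (t * ω) (N - 1) (b N) * c (t * ω) j x‖ = A at h1 ⊢
  generalize ‖s (t * ω) (N - 1) (b N)‖ = d at h2 h4 ⊢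
  refine le_of_mul_le_mul_left ?_ ht
  calc t * A ≤ C * Real.exp (t * |ω.im| * (b N - x)) := h1.2
    _ = C * (Real.exp (-(t * |ω.im| * (x - b 0))) * Real.exp (t * |ω.im| * (b N - b 0))) := by
      rw [← Real.exp_add]; ring_nf
    _ ≤ C * (Real.exp (-(t * |ω.im| * (x - b 0))) * (D * (t * d))) := by gcongr
    _ = _ := by ring

end FundamentalSystem

namespace FundamentalSystem

variable {N : ℕ} {b : ℕ → ℝ} {p p' q : ℝ → ℂ} {γ η' η : ℕ → ℂ} {s s' c c' : ℂ → ℕ → ℝ → ℂ}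
  {pt pt' qt : ℝ → ℂ} {η't ηt : ℕ → ℂ} {st st' ct ct' : ℂ → ℕ → ℝ → ℂ}

theorem ray_im_ne_zero : ∀ k < 4, ((1 + I) * I ^ k).im ≠ 0 := by
  intro k hk
  interval_cases k <;> simp [pow_succ]

/-- A holomorphic extension of the difference of two Weyl-type functions vanishes. -/
theorem weyl_eq (H : FundamentalSystem N b p p' q γ η' η s s' c c')
    (Ht : FundamentalSystem N b pt pt' qt γ η't ηt st st' ct ct')
    (hzero : ∀ z, s z (N - 1) (b N) = 0 ↔ st z (N - 1) (b N) = 0)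
    (hWeyl : ∀ ν : ℂ, s ν (N - 1) (b N) = 0 → ∃ F : ℂ → ℂ, AnalyticAt ℂ F ν ∧ ∀ᶠ ρ in 𝓝[≠] ν,
      F ρ = (-c ρ (N - 1) (b N) / s ρ (N - 1) (b N)) -
        (-ct ρ (N - 1) (b N) / st ρ (N - 1) (b N))) (ρ : ℂ) :
    -c ρ (N - 1) (b N) / s ρ (N - 1) (b N) = -ct ρ (N - 1) (b N) / st ρ (N - 1) (b N) := by
  classical
  set d : ℂ → ℂ := fun z => s z (N - 1) (b N) with hd
  set d₁ : ℂ → ℂ := fun z => c z (N - 1) (b N) with hd₁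
  set e : ℂ → ℂ := fun z => st z (N - 1) (b N) with he
  set e₁ : ℂ → ℂ := fun z => ct z (N - 1) (b N) with he₁
  have dd : Differentiable ℂ d := H.differentiable_sine H.pred_lt H.last_mem
  have dd₁ : Differentiable ℂ d₁ := H.differentiable_cosine H.pred_lt H.last_mem
  have de : Differentiable ℂ e := Ht.differentiable_sine H.pred_lt H.last_mem
  have de₁ : Differentiable ℂ e₁ := Ht.differentiable_cosine H.pred_lt H.last_mem
  have td : ExpType d := H.expType_sine H.pred_lt H.last_mem
  have td₁ : ExpType d₁ := H.expType_cosine H.pred_lt H.last_mem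
  have te : ExpType e := Ht.expType_sine H.pred_lt H.last_mem
  have te₁ : ExpType e₁ := Ht.expType_cosine H.pred_lt H.last_mem
  obtain ⟨a, ha⟩ : ∃ a, d a ≠ 0 := by
    obtain ⟨t, ht⟩ := (H.characteristic_ne_zero (ω := I) (by simp)).exists
    exact ⟨_, ht⟩
  have hne : ∀ ν, ∀ᶠ z in 𝓝[≠] ν, d z ≠ 0 := by
    intro ν
    rcases (dd.analyticAt ν).eventually_eq_zero_or_eventually_ne_zero with h | h
    · have := (dd.differentiableOn.analyticOnNhd isOpen_univ).eqOn_zero_of_preconnected_of_eventuallyEq_zero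
        isPreconnected_univ (mem_univ ν) h
      exact absurd (this (mem_univ a)) ha
    · exact h
  choose! G hGa hGe using hWeyl
  set F : ℂ → ℂ := fun z => if d z = 0 then G z z else -d₁ z / d z - -e₁ z / e z with hF
  have hFne : ∀ z, d z ≠ 0 → F z = -d₁ z / d z - -e₁ z / e z := fun z hz => by
    simp only [hF, if_neg hz]
  have hFd : Differentiable ℂ F := by
    intro ν
    by_cases hν : d ν = 0
    · refine (hGa ν hν).differentiableAt.congr_of_eventuallyEq ?_
      have h1 : ∀ᶠ z in 𝓝[≠] ν, F z = G ν z := by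
        filter_upwards [hne ν, hGe ν hν] with z h1 h2
        rw [hFne z h1, h2]
      have h2 : F ν = G ν ν := by simp only [hF, if_pos hν]
      exact (eventually_nhdsWithin_iff.1 h1).mono fun z hz => by
        by_cases h : z = ν
        · rw [h, h2]
        · exact hz h
    · have hν' : e ν ≠ 0 := fun h => hν ((hzero ν).2 h)
      have h1 : (fun z => -d₁ z / d z - -e₁ z / e z) =ᶠ[𝓝 ν] F :=
        (dd.continuous.continuousAt.eventually_ne hν).mono fun z hz => (hFne z hz).symm
      refine DifferentiableAt.congr_of_eventuallyEq ?_ h1.symm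
      exact ((dd₁ ν).neg.div (dd ν) hν).sub ((de₁ ν).neg.div (de ν) hν')
  have hFmul : (fun z => F z * (d z * e z)) = fun z => e₁ z * d z - d₁ z * e z := by
    funext z
    by_cases hz : d z = 0
    · have : e z = 0 := (hzero z).1 hz
      simp [hz, this]
    · have hz' : e z ≠ 0 := fun h => hz ((hzero z).2 h)
      rw [hFne z hz]
      field_simp
      ring
  have hFt : ExpType F := by
    refine ExpType.of_mul (c := a) hFd (dd.mul de) (td.mul te) ?_
      (mul_ne_zero ha fun h => ha ((hzero a).2 h))
    change ExpType fun z => F z * (d z * e z)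
    rw [hFmul]
    exact (te₁.mul td).sub (td₁.mul te)
  have hray : ∀ k < 4, Tendsto (fun t : ℝ => F (t * ((1 + I) * I ^ k))) atTop
      (𝓝 (Real.sign ((1 + I) * I ^ k).im * (I * ((p (b 0) - pt (b 0)) / 2)))) := by
    intro k hk
    have hω := ray_im_ne_zero k hk
    have h1 := ((H.weyl_ray hω).sub (Ht.weyl_ray hω)).add_const
      (Real.sign ((1 + I) * I ^ k).im * (I * ((p (b 0) - pt (b 0)) / 2)))
    rw [sub_zero, zero_add] at h1
    refine h1.congr' ?_
    filter_upwards [H.characteristic_ne_zero hω] with t ht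
    rw [hFne _ ht]
    simp only [hd, hd₁, he, he₁]
    ring
  have hconst := hFt.eq_of_tendsto_rays hFd (ω := 1 + I)
    (fun h => by simpa using congrArg Complex.im h) hray
  have h0 := hconst 0 (by norm_num)
  have h2 := hconst 2 (by norm_num)
  have hF0 : F ρ = 0 := by
    have i0 : Real.sign ((1 + I) * I ^ 0).im = 1 := by simp
    have i2 : Real.sign ((1 + I) * I ^ 2).im = -1 := Real.sign_of_neg (by simp)
    have e0 := h0 ρ
    have e2 := h2 ρ
    rw [i0] at e0
    rw [i2] at e2
    push_cast at e0 e2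
    linear_combination (e0 + e2) / 2
  by_cases hz : d ρ = 0
  · have : e ρ = 0 := (hzero ρ).1 hz
    change -d₁ ρ / d ρ = -e₁ ρ / e ρ
    rw [hz, this, div_zero, div_zero]
  · rw [hFne ρ hz] at hF0
    exact sub_eq_zero.1 hF0

/-- If the Weyl-type functions coincide, so do the ratios of the fundamental solutions. -/
theorem sine_mul_cosine_eq (H : FundamentalSystem N b p p' q γ η' η s s' c c')
    (Ht : FundamentalSystem N b pt pt' qt γ η't ηt st st' ct ct')
    (hM : ∀ ρ, -c ρ (N - 1) (b N) / s ρ (N - 1) (b N) =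
      -ct ρ (N - 1) (b N) / st ρ (N - 1) (b N)) (ρ : ℂ)
    {j : ℕ} (hj : j < N) {x : ℝ} (hx : x ∈ Icc (b j) (b (j + 1))) :
    s ρ j x * ct ρ j x = st ρ j x * c ρ j x := by
  have hInt : ∀ y ∈ Ioo (b j) (b (j + 1)), s ρ j y * ct ρ j y = st ρ j y * c ρ j y := by
    intro y hy
    have hy' := Ioo_subset_Icc_self hy
    have dU : Differentiable ℂ fun ρ => s ρ j y * ct ρ j y - st ρ j y * c ρ j y :=
      ((H.differentiable_sine hj hy').mul (Ht.differentiable_cosine hj hy')).sub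
        ((Ht.differentiable_sine hj hy').mul (H.differentiable_cosine hj hy'))
    have tU : ExpType fun ρ => s ρ j y * ct ρ j y - st ρ j y * c ρ j y :=
      ((H.expType_sine hj hy').mul (Ht.expType_cosine hj hy')).sub
        ((Ht.expType_sine hj hy').mul (H.expType_cosine hj hy'))
    refine sub_eq_zero.1 (tU.eq_of_tendsto_rays dU (ω := 1 + I) (L := fun _ => 0)
      (fun h => by simpa using congrArg Complex.im h) (fun k hk => ?_) 0 (by norm_num) ρ)
    have hω := ray_im_ne_zero k hk
    generalize (1 + I) * I ^ k = ω at hω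
    obtain ⟨A, hA, h1⟩ := H.sine_ray hω hj hy
    obtain ⟨B, hB, h2⟩ := Ht.weylSolution_ray hω hj hy
    obtain ⟨A', hA', h3⟩ := Ht.sine_ray hω hj hy
    obtain ⟨B', hB', h4⟩ := H.weylSolution_ray hω hj hy
    have hlim : Tendsto (fun t : ℝ => (A * B + A' * B') * t⁻¹) atTop (𝓝 0) := by
      simpa using (tendsto_inv_atTop_zero (𝕜 := ℝ)).const_mul (A * B + A' * B')
    refine squeeze_zero_norm' ?_ hlim
    filter_upwards [h1, h2, h3, h4, eventually_gt_atTop 0] with t h1 h2 h3 h4 ht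
    rw [show s (t * ω) j y * ct (t * ω) j y - st (t * ω) j y * c (t * ω) j y =
      s (t * ω) j y * (ct (t * ω) j y +
        -ct (t * ω) (N - 1) (b N) / st (t * ω) (N - 1) (b N) * st (t * ω) j y) -
      st (t * ω) j y * (c (t * ω) j y +
        -c (t * ω) (N - 1) (b N) / s (t * ω) (N - 1) (b N) * s (t * ω) j y) by
        rw [hM]; ring]
    refine (norm_sub_le _ _).trans ?_
    rw [norm_mul, norm_mul, ← div_eq_mul_inv, le_div_iff₀ ht]
    have hE : Real.exp (t * |ω.im| * (y - b 0)) * Real.exp (-(t * |ω.im| * (y - b 0))) = 1 := by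
      rw [← Real.exp_add, add_neg_cancel, Real.exp_zero]
    have m1 := mul_le_mul h1 h2 (norm_nonneg _) (by positivity)
    have m2 := mul_le_mul h3 h4 (norm_nonneg _) (by positivity)
    have r1 : A * Real.exp (t * |ω.im| * (y - b 0)) * (B * Real.exp (-(t * |ω.im| * (y - b 0)))) =
      A * B := by linear_combination (A * B) * hE
    have r2 : A' * Real.exp (t * |ω.im| * (y - b 0)) *
      (B' * Real.exp (-(t * |ω.im| * (y - b 0)))) = A' * B' := by
      linear_combination (A' * B') * hE
    rw [r1] at m1
    rw [r2] at m2
    linarith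
  have hlt := H.node_lt j hj
  refine Set.EqOn.of_subset_closure (f := fun x => s ρ j x * ct ρ j x)
    (g := fun x => st ρ j x * c ρ j x) (s := Ioo (b j) (b (j + 1))) (t := Icc (b j) (b (j + 1)))
    hInt ?_ ?_ Ioo_subset_Icc_self (by rw [closure_Ioo hlt.ne]) hx
  · exact ((H.sine ρ).continuousOn H.node_lt hj).mul ((Ht.cosine ρ).continuousOn H.node_lt hj)
  · exact ((Ht.sine ρ).continuousOn H.node_lt hj).mul ((H.cosine ρ).continuousOn H.node_lt hj)

end FundamentalSystem

/-- Equal primitives of continuous functions have equal integrands. -/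
theorem IsPrimitiveOn.eqOn_of_continuousOn {f f' g g' : ℝ → ℂ} {α β : ℝ} (hαβ : α < β)
    (hf : IsPrimitiveOn f f' α β) (hg : IsPrimitiveOn g g' α β)
    (hfg : ∀ x ∈ Icc α β, f x = g x) (hf' : ContinuousOn f' (Icc α β))
    (hg' : ContinuousOn g' (Icc α β)) : ∀ x ∈ Icc α β, f' x = g' x := by
  have h := hf.ae_eq hg fun x hx => hfg x (Ioo_subset_Icc_self hx)
  refine Measure.eqOn_Icc_of_ae_eq (μ := volume) hαβ.ne ?_ hf' hg'
  rw [← Measure.restrict_congr_set Ioo_ae_eq_Icc]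
  exact (ae_restrict_iff' measurableSet_Ioo).2 h

/-- Solutions of two Schrödinger-type equations with equal squares. -/
theorem sq_eq_sq_rigidity {z z' w w' Q P : ℝ → ℂ} {α β : ℝ} (hαβ : α < β)
    (hz : IsPrimitiveOn z z' α β) (hz' : IsPrimitiveOn z' (fun x => -(Q x * z x)) α β)
    (hw : IsPrimitiveOn w w' α β) (hw' : IsPrimitiveOn w' (fun x => -(P x * w x)) α β)
    (hzw : ∀ x ∈ Icc α β, z x * z x = w x * w x) :
    (∀ x ∈ Icc α β, z x * z' x = w x * w' x) ∧
      ∀ᵐ x, x ∈ Ioo α β → (Q x - P x) * z x = 0 := by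
  have cz := hz.continuousOn hαβ.le
  have cz' := hz'.continuousOn hαβ.le
  have cw := hw.continuousOn hαβ.le
  have cw' := hw'.continuousOn hαβ.le
  have h1 : ∀ x ∈ Icc α β, z x * z' x = w x * w' x := by
    intro x hx
    have := IsPrimitiveOn.eqOn_of_continuousOn hαβ (hz.mul hαβ.le hz) (hw.mul hαβ.le hw) hzw
      ((cz'.mul cz).add (cz.mul cz')) ((cw'.mul cw).add (cw.mul cw')) x hx
    linear_combination this / 2
  refine ⟨h1, ?_⟩
  filter_upwards [(hz.mul hαβ.le hz').ae_eq (hw.mul hαβ.le hw')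
    fun x hx => h1 x (Ioo_subset_Icc_self hx)] with x h2 hx
  have e1 := h1 x (Ioo_subset_Icc_self hx)
  have e0 := hzw x (Ioo_subset_Icc_self hx)
  have e2 := h2 hx
  have : (Q x - P x) * z x * z x ^ 3 = 0 := by
    linear_combination (-z x ^ 2) * e2 + (z x * z' x + w x * w' x) * e1 +
      (-(P x * z x ^ 2) - w' x ^ 2) * e0
  rcases mul_eq_zero.1 this with h | h
  · exact h
  · rw [pow_eq_zero_iff (by norm_num) |>.1 h, mul_zero]

theorem exists_mem_Ioo_node {b : ℕ → ℝ} {x : ℝ} {N : ℕ} (hx : x ∈ Ioo (b 0) (b N))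
    (hne : ∀ j, x ≠ b j) : ∃ j < N, x ∈ Ioo (b j) (b (j + 1)) := by
  induction N with
  | zero => exact absurd (hx.1.trans hx.2) (lt_irrefl _)
  | succ n ih =>
    rcases lt_or_gt_of_ne (hne n) with h | h
    · obtain ⟨j, hj, hj'⟩ := ih ⟨hx.1, h⟩
      exact ⟨j, by omega, hj'⟩
    · exact ⟨n, by omega, h, hx.2⟩

namespace FundamentalSystem

variable {N : ℕ} {b : ℕ → ℝ} {p p' q : ℝ → ℂ} {γ η' η : ℕ → ℂ} {s s' c c' : ℂ → ℕ → ℝ → ℂ}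
  {pt pt' qt : ℝ → ℂ} {η't ηt : ℕ → ℂ} {st st' ct ct' : ℂ → ℕ → ℝ → ℂ}

/-- Equal ratios of fundamental solutions force equal squares. -/
theorem mul_self_eq (H : FundamentalSystem N b p p' q γ η' η s s' c c')
    (Ht : FundamentalSystem N b pt pt' qt γ η't ηt st st' ct ct') (ρ : ℂ) {j : ℕ} (hj : j < N)
    (hE : ∀ x ∈ Icc (b j) (b (j + 1)), s ρ j x * ct ρ j x = st ρ j x * c ρ j x) :
    ∀ x ∈ Icc (b j) (b (j + 1)),
      c ρ j x * c ρ j x = ct ρ j x * ct ρ j x ∧ s ρ j x * s ρ j x = st ρ j x * st ρ j x := by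
  intro x hx
  have hlt := H.node_lt j hj
  have cs := (H.sine ρ).continuousOn H.node_lt hj
  have cs' := (H.sine ρ).continuousOn' H.node_lt hj
  have cc := (H.cosine ρ).continuousOn H.node_lt hj
  have cc' := (H.cosine ρ).continuousOn' H.node_lt hj
  have cst := (Ht.sine ρ).continuousOn H.node_lt hj
  have cst' := (Ht.sine ρ).continuousOn' H.node_lt hj
  have cct := (Ht.cosine ρ).continuousOn H.node_lt hj
  have cct' := (Ht.cosine ρ).continuousOn' H.node_lt hj
  have e1 := IsPrimitiveOn.eqOn_of_continuousOn hlt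
    (((H.sine ρ).prim j hj).mul hlt.le ((Ht.cosine ρ).prim j hj))
    (((Ht.sine ρ).prim j hj).mul hlt.le ((H.cosine ρ).prim j hj)) hE
    ((cs'.mul cct).add (cs.mul cct')) ((cst'.mul cc).add (cst.mul cc')) x hx
  have e0 := hE x hx
  have W := H.wronskian ρ hj hx
  have Wt := Ht.wronskian ρ hj hx
  generalize s ρ j x = S at *
  generalize c ρ j x = C at *
  generalize st ρ j x = St at *
  generalize ct ρ j x = Ct at *
  generalize s' ρ j x = S' at *
  generalize c' ρ j x = C' at *
  generalize st' ρ j x = St' at *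
  generalize ct' ρ j x = Ct' at *
  constructor
  · linear_combination (-C * Ct) * e1 + (Ct ^ 2) * W - C ^ 2 * Wt + (C * Ct' + Ct * C') * e0
  · linear_combination (-S * St) * e1 + (St ^ 2) * W - S ^ 2 * Wt + (S' * St + S * St') * e0

/-- Pencils whose fundamental solutions have equal ratios coincide. -/
theorem data_eq (H : FundamentalSystem N b p p' q γ η' η s s' c c')
    (Ht : FundamentalSystem N b pt pt' qt γ η't ηt st st' ct ct')
    (hE : ∀ ρ, ∀ j < N, ∀ x ∈ Icc (b j) (b (j + 1)), s ρ j x * ct ρ j x = st ρ j x * c ρ j x) :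
    (∀ᵐ x, x ∈ Ioo (b 0) (b N) → p x = pt x ∧ q x = qt x) ∧
      ∀ j, 1 ≤ j → j + 1 ≤ N → η' j = η't j ∧ η j = ηt j := by
  have hsq := fun ρ j hj => H.mul_self_eq Ht ρ hj (hE ρ j hj)
  have hc := fun ρ j hj => sq_eq_sq_rigidity (H.node_lt j hj) ((H.cosine ρ).prim j hj)
    ((H.cosine ρ).prim' j hj) ((Ht.cosine ρ).prim j hj) ((Ht.cosine ρ).prim' j hj)
    fun x hx => (hsq ρ j hj x hx).1
  have hs := fun ρ j hj => sq_eq_sq_rigidity (H.node_lt j hj) ((H.sine ρ).prim j hj)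
    ((H.sine ρ).prim' j hj) ((Ht.sine ρ).prim j hj) ((Ht.sine ρ).prim' j hj)
    fun x hx => (hsq ρ j hj x hx).2
  have hQ : ∀ ρ, ∀ j < N, ∀ᵐ x, x ∈ Ioo (b j) (b (j + 1)) →
      pencilPotential p q ρ x = pencilPotential pt qt ρ x := by
    intro ρ j hj
    filter_upwards [(hc ρ j hj).2, (hs ρ j hj).2] with x h1 h2 hx
    have W := H.wronskian ρ hj (Ioo_subset_Icc_self hx)
    linear_combination s' ρ j x * h1 hx - c' ρ j x * h2 hx -
      (pencilPotential p q ρ x - pencilPotential pt qt ρ x) * W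
  have hσ : ∀ ρ j, j + 1 < N → jumpCoeff η' η ρ (j + 1) = jumpCoeff η't ηt ρ (j + 1) := by
    intro ρ j hj
    have hj0 : j < N := by omega
    have hg := H.ne_zero (j + 1) (by omega) (by omega)
    have hr : b (j + 1) ∈ Icc (b j) (b (j + 1)) := ⟨(H.node_lt j hj0).le, le_rfl⟩
    have hl : b (j + 1) ∈ Icc (b (j + 1)) (b (j + 1 + 1)) := ⟨le_rfl, (H.node_lt (j + 1) hj).le⟩
    have key : ∀ {u u' v v' g σ τ : ℂ}, g ≠ 0 → u * u = v * v → u * u' = v * v' →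
        (g * u) * (g⁻¹ * u' + σ * u) = (g * v) * (g⁻¹ * v' + τ * v) → (σ - τ) * u = 0 := by
      intro u u' v v' g σ τ hg h0 h1 h2
      field_simp at h2
      have : (σ - τ) * u * (g * u) = 0 := by
        linear_combination h2 - h1 - g * τ * h0
      rcases mul_eq_zero.1 this with h | h
      · exact h
      · rw [(mul_eq_zero.1 h).resolve_left hg, mul_zero]
    have kc := (hc ρ (j + 1) hj).1 _ hl
    rw [(H.cosine ρ).jump j hj, (H.cosine ρ).jump' j hj, (Ht.cosine ρ).jump j hj,
      (Ht.cosine ρ).jump' j hj] at kc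
    have ks := (hs ρ (j + 1) hj).1 _ hl
    rw [(H.sine ρ).jump j hj, (H.sine ρ).jump' j hj, (Ht.sine ρ).jump j hj,
      (Ht.sine ρ).jump' j hj] at ks
    have kc' := key hg (hsq ρ j hj0 _ hr).1 ((hc ρ j hj0).1 _ hr) kc
    have ks' := key hg (hsq ρ j hj0 _ hr).2 ((hs ρ j hj0).1 _ hr) ks
    have W := H.wronskian ρ hj0 hr
    linear_combination s' ρ j (b (j + 1)) * kc' - c' ρ j (b (j + 1)) * ks' -
      (jumpCoeff η' η ρ (j + 1) - jumpCoeff η't ηt ρ (j + 1)) * W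
  constructor
  · have hall : ∀ ρ, ∀ᵐ x, ∀ j, j < N → x ∈ Ioo (b j) (b (j + 1)) →
        pencilPotential p q ρ x = pencilPotential pt qt ρ x := fun ρ =>
      ae_all_iff.2 fun j => by
        by_cases hj : j < N
        · filter_upwards [hQ ρ j hj] with x hx _ using hx
        · exact Eventually.of_forall fun x h => absurd h hj
    have hnode : ∀ᵐ x : ℝ, ∀ j, x ≠ b j := ae_all_iff.2 fun j => Measure.ae_ne volume (b j)
    filter_upwards [hall 0, hall 1, hnode] with x h0 h1 hn hx
    obtain ⟨j, hj, hj'⟩ := exists_mem_Ioo_node hx hn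
    have e0 := h0 j hj hj'
    have e1 := h1 j hj hj'
    simp only [pencilPotential] at e0 e1
    exact ⟨by linear_combination e1 - e0, by linear_combination e0⟩
  · intro j h1 h2
    obtain ⟨i, rfl⟩ : ∃ i, j = i + 1 := ⟨j - 1, by omega⟩
    have e0 := hσ 0 i h2
    have e1 := hσ 1 i h2
    simp only [jumpCoeff] at e0 e1
    refine ⟨?_, by linear_combination e0⟩
    refine mul_left_cancel₀ I_ne_zero ?_
    linear_combination e1 - e0

end FundamentalSystem

/-- **Theorem 1, uniqueness for IP-0.** Two boundary value problems
with the same `T, N`, nodes `b j` and jump coefficients `γ j ≠ 0`, with data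
`(p, q, η', η)` and `(pt, qt, η't, ηt)` respectively, and with
`ξ_j^± = (γ_j + γ_j⁻¹)/2 ∓ η'_j/2 ≠ 0` for both problems.  `SS, CC` (resp. `SSt, CCt`)
are the fundamental solutions with jumps, `d ρ = S(T-0,ρ)`, `d₁ ρ = C(T-0,ρ)`.
If (i) every `z ∈ ℂ` has the same order as a zero of `d` and of `dt`, and (ii) at
every such zero the principal parts of the Weyl-type functions `M = -d₁/d` and
`Mt = -d₁t/dt` coincide (i.e. `M - Mt` extends analytically), then `p = pt` a.e.,
`q = qt` a.e. on `(0,T)`, and `η'_j = η't_j`, `η_j = ηt_j` for `j = 1, …, N-1`. -/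
theorem IP0_uniqueness
    (T : ℝ) (N : ℕ) (b : ℕ → ℝ) (γ : ℕ → ℂ)
    (p q pt qt : ℝ → ℂ) (η' η η't ηt : ℕ → ℂ)
    (hT : 0 < T) (hN : 1 ≤ N) (hb0 : b 0 = 0) (hbN : b N = T)
    (hb : ∀ j, j < N → b j < b (j + 1))
    (hγ : ∀ j, 1 ≤ j → j + 1 ≤ N → γ j ≠ 0)
    (hp : AbsCont p 0 T) (hq : MeasureTheory.IntegrableOn q (Set.Icc 0 T))
    (hpt : AbsCont pt 0 T) (hqt : MeasureTheory.IntegrableOn qt (Set.Icc 0 T))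
    (hξ : ∀ j, 1 ≤ j → j + 1 ≤ N →
      (γ j + (γ j)⁻¹) / 2 - η' j / 2 ≠ 0 ∧ (γ j + (γ j)⁻¹) / 2 + η' j / 2 ≠ 0)
    (hξt : ∀ j, 1 ≤ j → j + 1 ≤ N →
      (γ j + (γ j)⁻¹) / 2 - η't j / 2 ≠ 0 ∧ (γ j + (γ j)⁻¹) / 2 + η't j / 2 ≠ 0)
    (SS CC : ∀ ρ : ℂ, JumpSolution N b p q γ η' η ρ)
    (SSt CCt : ∀ ρ : ℂ, JumpSolution N b pt qt γ η't ηt ρ)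
    (hS : ∀ ρ, (SS ρ).yR 0 = 0 ∧ (SS ρ).yR' 0 = 1)
    (hC : ∀ ρ, (CC ρ).yR 0 = 1 ∧ (CC ρ).yR' 0 = 0)
    (hSt : ∀ ρ, (SSt ρ).yR 0 = 0 ∧ (SSt ρ).yR' 0 = 1)
    (hCt : ∀ ρ, (CCt ρ).yR 0 = 1 ∧ (CCt ρ).yR' 0 = 0)
    (hOrder : ∀ z : ℂ, ∀ m : ℕ,
      (∀ j < m, iteratedDeriv j (fun ρ => (SS ρ).yL N) z = 0) ↔
      (∀ j < m, iteratedDeriv j (fun ρ => (SSt ρ).yL N) z = 0))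
    (hWeyl : ∀ ν : ℂ, (SS ν).yL N = 0 →
      ∃ F : ℂ → ℂ, AnalyticAt ℂ F ν ∧
        ∀ᶠ ρ in 𝓝[≠] ν,
          F ρ = (-(CC ρ).yL N / (SS ρ).yL N) - (-(CCt ρ).yL N / (SSt ρ).yL N)) :
    (∀ᵐ x ∂(volume.restrict (Set.Ioo (0 : ℝ) T)), p x = pt x ∧ q x = qt x) ∧
    (∀ j, 1 ≤ j → j + 1 ≤ N → η' j = η't j ∧ η j = ηt j) := by
  have hbN0 : b 0 ≤ b N := node_le_node hb (Nat.zero_le N) le_rfl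
  have hInt : ∀ {f : ℝ → ℂ}, IntegrableOn f (Icc 0 T) → IntervalIntegrable f volume (b 0) (b N) := by
    intro f hf
    rw [← hb0, ← hbN] at hf
    exact (intervalIntegrable_iff_integrableOn_Icc_of_le hbN0).2 hf
  have hprim : ∀ {f : ℝ → ℂ}, AbsCont f 0 T → ∃ f', IsPrimitiveOn f f' (b 0) (b N) := by
    rintro f ⟨f', h1, h2⟩
    refine ⟨f', hInt h1, ?_⟩
    rw [hb0, hbN]
    exact h2
  obtain ⟨p', hp'⟩ := hprim hp
  obtain ⟨pt', hpt'⟩ := hprim hpt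
  have cp := hp'.continuousOn hbN0
  have cpt := hpt'.continuousOn hbN0
  have H : FundamentalSystem N b p p' q γ η' η (fun ρ => (SS ρ).piece) (fun ρ => (SS ρ).piece')
      (fun ρ => (CC ρ).piece) (fun ρ => (CC ρ).piece') :=
    { pos := hN, node_lt := hb, ne_zero := hγ, nondeg := hξ, prim := hp', integrable := hInt hq
      sine := fun ρ => (SS ρ).pieceSol hb cp (hInt hq)
      cosine := fun ρ => (CC ρ).pieceSol hb cp (hInt hq)
      sine_zero := fun ρ => (SS ρ).piece_zero.trans (hS ρ).1
      sine'_zero := fun ρ => (SS ρ).piece'_zero.trans (hS ρ).2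
      cosine_zero := fun ρ => (CC ρ).piece_zero.trans (hC ρ).1
      cosine'_zero := fun ρ => (CC ρ).piece'_zero.trans (hC ρ).2 }
  have Ht : FundamentalSystem N b pt pt' qt γ η't ηt (fun ρ => (SSt ρ).piece)
      (fun ρ => (SSt ρ).piece') (fun ρ => (CCt ρ).piece) (fun ρ => (CCt ρ).piece') :=
    { pos := hN, node_lt := hb, ne_zero := hγ, nondeg := hξt, prim := hpt', integrable := hInt hqt
      sine := fun ρ => (SSt ρ).pieceSol hb cpt (hInt hqt)
      cosine := fun ρ => (CCt ρ).pieceSol hb cpt (hInt hqt)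
      sine_zero := fun ρ => (SSt ρ).piece_zero.trans (hSt ρ).1
      sine'_zero := fun ρ => (SSt ρ).piece'_zero.trans (hSt ρ).2
      cosine_zero := fun ρ => (CCt ρ).piece_zero.trans (hCt ρ).1
      cosine'_zero := fun ρ => (CCt ρ).piece'_zero.trans (hCt ρ).2 }
  have hM := H.weyl_eq Ht
    (fun z => by
      simp only [JumpSolution.piece_last _ hb hN]
      simpa using hOrder z 1)
    (by simpa only [JumpSolution.piece_last _ hb hN] using hWeyl)
  have hdata := H.data_eq Ht fun ρ j hj x hx => H.sine_mul_cosine_eq Ht hM ρ hj hx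
  rw [hb0, hbN] at hdata
  exact ⟨(ae_restrict_iff' measurableSet_Ioo).2 hdata.1, hdata.2⟩
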